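/- Let (X,ρ,μ) be a quasi-metric measure space in which μ is Borel regular and Q-doubling for some Q ∈ (0,∞), and let Ω ⊂ X be a μ-measurable locally uniformly perfect set. Suppose Ω is an N^s_{p,q}-extension domain for some p ∈ (0,∞), q ∈ (0,∞], and s ∈ (0,∞) with s < ind(X,ρ) (i.e. there exists a quasi-metric ϱ on X equivalent to ρ with s < (log₂ C_ϱ)^{−1}); that is, there exists C > 0 such that every u ∈ N^s_{p,q}(Ω,ρ,μ) admits ũ ∈ N^s_{p,q}(X,ρ,μ) with ũ|_Ω = u and ‖ũ‖_{N^s_{p,q}(X,ρ,μ)} ≤ C ‖u‖_{N^s_{p,q}(Ω,ρ,μ)}. Then Ω satisfies the measure density condition: there is C_μ > 0 with μ(B_ρ(x,r)) ≤ C_μ μ(B_ρ(x,r)∩Ω) for all x ∈ Ω and r ∈ (0,1]. -/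

import Mathlib

open MeasureTheory ENNReal Set

noncomputable section

namespace HajlaszPaper

variable {X : Type*}

/-- The `ρ`-ball centered at `x` with radius `r`. -/
def qball (ρ : X → X → ℝ) (x : X) (r : ℝ) : Set X := {y | ρ x y < r}

/-- `ρ` is a quasi-metric on `X`. -/
def IsQuasiDist (ρ : X → X → ℝ) : Prop :=
  (∀ x y, 0 ≤ ρ x y) ∧ (∀ x y, ρ x y = 0 ↔ x = y) ∧
    (∃ C₀ : ℝ, 1 ≤ C₀ ∧ ∀ x y, ρ y x ≤ C₀ * ρ x y) ∧
    (∃ C₁ : ℝ, 1 ≤ C₁ ∧ ∀ x y z, ρ x y ≤ C₁ * max (ρ x z) (ρ z y))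

/-- The least admissible quasi-triangle constant `C_ρ`. -/
def Crho (ρ : X → X → ℝ) : ℝ :=
  sInf {C : ℝ | 1 ≤ C ∧ ∀ x y z : X, ρ x y ≤ C * max (ρ x z) (ρ z y)}

/-- The least admissible quasi-symmetry constant `C̃_ρ`. -/
def CrhoTilde (ρ : X → X → ℝ) : ℝ :=
  sInf {C : ℝ | 1 ≤ C ∧ ∀ x y : X, ρ y x ≤ C * ρ x y}

/-- Two quasi-metrics are (bi-Lipschitz, i.e. pointwise) equivalent. -/
def EquivQM (ρ ϱ : X → X → ℝ) : Prop :=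
  ∃ c : ℝ, 1 ≤ c ∧ ∀ x y, c⁻¹ * ϱ x y ≤ ρ x y ∧ ρ x y ≤ c * ϱ x y

variable [MeasurableSpace X]

/-- `(X, ρ, μ)` is a quasi-metric measure space. -/
structure IsQMMS (ρ : X → X → ℝ) (μ : Measure X) : Prop where
  nontrivial : ∃ x y : X, x ≠ y
  quasi : IsQuasiDist ρ
  measurableSet_ball : ∀ (x : X) (r : ℝ), 0 < r → MeasurableSet (qball ρ x r)
  ball_pos : ∀ (x : X) (r : ℝ), 0 < r → 0 < μ (qball ρ x r)
  ball_lt_top : ∀ (x : X) (r : ℝ), 0 < r → μ (qball ρ x r) < ∞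

/-- Every `μ`-measurable set is contained in a Borel (measurable) set of equal measure. -/
def BorelRegular (μ : Measure X) : Prop :=
  ∀ A : Set X, ∃ B : Set X, A ⊆ B ∧ MeasurableSet B ∧ μ A = μ B

/-- `μ` is `Q`-doubling. -/
def QDoubling (ρ : X → X → ℝ) (μ : Measure X) (Q : ℝ) : Prop :=
  ∃ κ : ℝ, 0 < κ ∧ ∀ (x y : X) (r R : ℝ), 0 < r → r ≤ R →
    qball ρ x r ⊆ qball ρ y R →
    ENNReal.ofReal (κ * (r / R) ^ Q) * μ (qball ρ y R) ≤ μ (qball ρ x r)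

/-- `μ` is doubling. -/
def DoublingMeas (ρ : X → X → ℝ) (μ : Measure X) : Prop :=
  ∃ Cd : ℝ, 0 < Cd ∧ ∀ (x : X) (r : ℝ), 0 < r →
    μ (qball ρ x (2 * r)) ≤ ENNReal.ofReal Cd * μ (qball ρ x r)

/-- The measure density condition for `Ω`. -/
def MeasDensity (ρ : X → X → ℝ) (μ : Measure X) (Ω : Set X) : Prop :=
  ∃ c : ℝ, 0 < c ∧ ∀ x ∈ Ω, ∀ r : ℝ, 0 < r → r ≤ 1 →
    μ (qball ρ x r) ≤ ENNReal.ofReal c * μ (qball ρ x r ∩ Ω)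

/-- `Ω` is locally uniformly perfect with constant `lam ∈ (0,1)`. -/
def LocUnifPerfect (ρ : X → X → ℝ) (Ω : Set X) (lam : ℝ) : Prop :=
  ∀ x ∈ Ω, ∀ r : ℝ, 0 < r → r ≤ 1 → (Ω \ qball ρ x r).Nonempty →
    ((qball ρ x r ∩ Ω) \ qball ρ x (lam * r)).Nonempty

/-- The critical radius `φ^x_{Ω,ρ}(r)`. -/
def phiRad (ρ : X → X → ℝ) (μ : Measure X) (Ω : Set X) (x : X) (r : ℝ) : ℝ :=
  sSup {t : ℝ | 0 ≤ t ∧ t ≤ r ∧ μ (qball ρ x t ∩ Ω) ≤ μ (qball ρ x r ∩ Ω) / 2}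

/-- The collection `𝔻^s_ρ(u)` of fractional `s`-gradients of `u` on `Ω`. -/
def fracGrad (ρ : X → X → ℝ) (μ : Measure X) (Ω : Set X) (s : ℝ) (u : X → ℝ) :
    Set (ℤ → X → ℝ) :=
  {g | (∀ k x, 0 ≤ g k x) ∧ (∀ k, AEMeasurable (g k) (μ.restrict Ω)) ∧
    ∃ E : Set X, μ E = 0 ∧ ∀ k : ℤ, ∀ x ∈ Ω \ E, ∀ y ∈ Ω \ E,
      (2 : ℝ) ^ (-k - 1) ≤ ρ x y → ρ x y < (2 : ℝ) ^ (-k) →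
      |u x - u y| ≤ ρ x y ^ s * (g k x + g k y)}

/-- `g` is an `s`-gradient of `u` on `S`. -/
def IsSGradOn (ρ : X → X → ℝ) (μ : Measure X) (S : Set X) (s : ℝ) (u g : X → ℝ) : Prop :=
  (∀ x, 0 ≤ g x) ∧ AEMeasurable g (μ.restrict S) ∧
    ∃ E : Set X, μ E = 0 ∧ ∀ x ∈ S \ E, ∀ y ∈ S \ E,
      |u x - u y| ≤ ρ x y ^ s * (g x + g y)

/-- The `ℓ^q` norm (`0 < q ≤ ∞`) of a `ℤ`-indexed sequence in `[0,∞]`. -/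
def lqN (q : ℝ≥0∞) (a : ℤ → ℝ≥0∞) : ℝ≥0∞ :=
  if q = ∞ then ⨆ k, a k else (∑' k, a k ^ q.toReal) ^ (1 / q.toReal)

/-- The `L^p` "norm" (`0 < p < ∞`) of a `[0,∞]`-valued function. -/
def lpN (μ : Measure X) (p : ℝ) (f : X → ℝ≥0∞) : ℝ≥0∞ :=
  (∫⁻ x, f x ^ p ∂μ) ^ (1 / p)

/-- The `L^p` norm of `u : X → ℝ` over the set `Ω`. -/
def lpOn (μ : Measure X) (Ω : Set X) (p : ℝ) (u : X → ℝ) : ℝ≥0∞ :=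
  lpN (μ.restrict Ω) p fun x => ENNReal.ofReal |u x|

/-- The homogeneous Hajłasz–Triebel–Lizorkin quasi-norm `‖u‖_{Ṁ^s_{p,q}(Ω,ρ,μ)}`. -/
def MdotNorm (ρ : X → X → ℝ) (μ : Measure X) (Ω : Set X) (s p : ℝ) (q : ℝ≥0∞)
    (u : X → ℝ) : ℝ≥0∞ :=
  ⨅ g ∈ fracGrad ρ μ Ω s u,
    lpN (μ.restrict Ω) p fun x => lqN q fun k => ENNReal.ofReal (g k x)

/-- The homogeneous Hajłasz–Besov quasi-norm `‖u‖_{Ṅ^s_{p,q}(Ω,ρ,μ)}`. -/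
def NdotNorm (ρ : X → X → ℝ) (μ : Measure X) (Ω : Set X) (s p : ℝ) (q : ℝ≥0∞)
    (u : X → ℝ) : ℝ≥0∞ :=
  ⨅ g ∈ fracGrad ρ μ Ω s u,
    lqN q fun k => lpN (μ.restrict Ω) p fun x => ENNReal.ofReal (g k x)

/-- Membership in `M^s_{p,q}(Ω,ρ,μ)`. -/
def MemMspq (ρ : X → X → ℝ) (μ : Measure X) (Ω : Set X) (s p : ℝ) (q : ℝ≥0∞)
    (u : X → ℝ) : Prop :=
  AEMeasurable u (μ.restrict Ω) ∧ lpOn μ Ω p u ≠ ∞ ∧ MdotNorm ρ μ Ω s p q u ≠ ∞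

/-- Membership in `N^s_{p,q}(Ω,ρ,μ)`. -/
def MemNspq (ρ : X → X → ℝ) (μ : Measure X) (Ω : Set X) (s p : ℝ) (q : ℝ≥0∞)
    (u : X → ℝ) : Prop :=
  AEMeasurable u (μ.restrict Ω) ∧ lpOn μ Ω p u ≠ ∞ ∧ NdotNorm ρ μ Ω s p q u ≠ ∞

/-- The quasi-norm of `M^s_{p,q}(Ω,ρ,μ)`. -/
def MNorm (ρ : X → X → ℝ) (μ : Measure X) (Ω : Set X) (s p : ℝ) (q : ℝ≥0∞)
    (u : X → ℝ) : ℝ≥0∞ :=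
  MdotNorm ρ μ Ω s p q u + lpOn μ Ω p u

/-- The quasi-norm of `N^s_{p,q}(Ω,ρ,μ)`. -/
def NNorm (ρ : X → X → ℝ) (μ : Measure X) (Ω : Set X) (s p : ℝ) (q : ℝ≥0∞)
    (u : X → ℝ) : ℝ≥0∞ :=
  NdotNorm ρ μ Ω s p q u + lpOn μ Ω p u

/-- `s ⪯_q ind(X,ρ)` : there is a quasi-metric `ϱ ≈ ρ` with `s ≤ (log₂ C_ϱ)⁻¹`
(equivalently `C_ϱ ^ s ≤ 2`), where equality is permitted only when `q = ∞`. -/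
def SPrecIndex (ρ : X → X → ℝ) (s : ℝ) (q : ℝ≥0∞) : Prop :=
  ∃ ϱ : X → X → ℝ, IsQuasiDist ϱ ∧ EquivQM ρ ϱ ∧
    (Crho ϱ ^ s < 2 ∨ (q = ∞ ∧ Crho ϱ ^ s ≤ 2))

/-- `s < ind(X,ρ)` : there is a quasi-metric `ϱ ≈ ρ` with `s < (log₂ C_ϱ)⁻¹`
(equivalently `C_ϱ ^ s < 2`). -/
def SLtIndex (ρ : X → X → ℝ) (s : ℝ) : Prop :=
  ∃ ϱ : X → X → ℝ, IsQuasiDist ϱ ∧ EquivQM ρ ϱ ∧ Crho ϱ ^ s < 2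

/-- The median value `m_u(E)`. -/
def medianVal (μ : Measure X) (E : Set X) (u : X → ℝ) : ℝ :=
  sSup {θ : ℝ | μ {x ∈ E | u x < θ} ≤ μ E / 2}

/-- `f` belongs to the homogeneous Hölder space `Ċ^α(X,ρ)`. -/
def MemHolder (ρ : X → X → ℝ) (α : ℝ) (f : X → ℝ) : Prop :=
  ∃ H : ℝ, 0 ≤ H ∧ ∀ x y : X, |f x - f y| ≤ H * ρ x y ^ α

/-- The Hölder seminorm `‖f‖_{Ċ^α(X,ρ)}`. -/
def holderNorm (ρ : X → X → ℝ) (α : ℝ) (f : X → ℝ) : ℝ :=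
  sInf {H : ℝ | 0 ≤ H ∧ ∀ x y : X, |f x - f y| ≤ H * ρ x y ^ α}

/-- The sup norm of `f`. -/
def supNorm (f : X → ℝ) : ℝ := sSup (Set.range fun x => |f x|)

/-- `ρ` is a genuine metric. -/
def IsMetricDist (ρ : X → X → ℝ) : Prop :=
  (∀ x y, 0 ≤ ρ x y) ∧ (∀ x y, ρ x y = 0 ↔ x = y) ∧ (∀ x y, ρ x y = ρ y x) ∧
    (∀ x y z, ρ x y ≤ ρ x z + ρ z y)

/-- The homogeneous Hajłasz–Sobolev quasi-norm `‖u‖_{Ṁ^{1,p}(Ω,ρ,μ)}`. -/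
def M1pDotNorm (ρ : X → X → ℝ) (μ : Measure X) (Ω : Set X) (p : ℝ) (u : X → ℝ) : ℝ≥0∞ :=
  ⨅ g ∈ {g : X → ℝ | IsSGradOn ρ μ Ω 1 u g},
    lpN (μ.restrict Ω) p fun x => ENNReal.ofReal (g x)

/-- Membership in the Hajłasz–Sobolev space `M^{1,p}(Ω,ρ,μ)`. -/
def MemM1p (ρ : X → X → ℝ) (μ : Measure X) (Ω : Set X) (p : ℝ) (u : X → ℝ) : Prop :=
  AEMeasurable u (μ.restrict Ω) ∧ lpOn μ Ω p u ≠ ∞ ∧ M1pDotNorm ρ μ Ω p u ≠ ∞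

/-- The quasi-norm of `M^{1,p}(Ω,ρ,μ)`. -/
def M1pNorm (ρ : X → X → ℝ) (μ : Measure X) (Ω : Set X) (p : ℝ) (u : X → ℝ) : ℝ≥0∞ :=
  lpOn μ Ω p u + M1pDotNorm ρ μ Ω p u

omit [MeasurableSpace X] in
/-- Frink's chain lemma: a function satisfying the quasi-triangle inequality with constant `2`
is controlled by its sums along chains. -/
theorem frink_chain {D : X → X → ℝ} (h0 : ∀ a b, 0 ≤ D a b)
    (h2 : ∀ a b c, D a b ≤ 2 * max (D a c) (D c b)) (x : ℕ → X) (n : ℕ) :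
    ∀ i j, j - i = n → i + 2 ≤ j →
      D (x i) (x j) + 2 * D (x i) (x (i + 1)) + 2 * D (x (j - 1)) (x j) ≤
        4 * ∑ k ∈ Finset.Ico i j, D (x k) (x (k + 1)) := by
  induction n using Nat.strong_induction_on with
  | _ n ih =>
  intro i j hn hij
  classical
  set f : ℕ → ℝ := fun k => D (x k) (x (k + 1)) with hf
  have hf0 : ∀ k, 0 ≤ f k := fun k => h0 _ _
  have ends : f i + f (j - 1) ≤ ∑ k ∈ Finset.Ico i j, f k := by
    rw [Finset.sum_eq_sum_Ico_succ_bot (by omega)]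
    have : f (j - 1) ≤ ∑ k ∈ Finset.Ico (i + 1) j, f k :=
      Finset.single_le_sum (fun k _ => hf0 k) (Finset.mem_Ico.2 (by omega))
    linarith
  have hlast : D (x (j - 1)) (x j) = f (j - 1) := by
    simp only [hf]; congr 2; omega
  have hfirst : D (x i) (x (i + 1)) = f i := rfl
  obtain ⟨r, hir, hrj, hr, hr'⟩ : ∃ r, i ≤ r ∧ r < j ∧ D (x i) (x j) ≤ 2 * D (x r) (x j) ∧
      (r + 1 < j → D (x i) (x j) ≤ 2 * D (x i) (x (r + 1))) := by
    let P : ℕ → Prop := fun r => i ≤ r ∧ D (x i) (x j) ≤ 2 * D (x r) (x j)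
    have hPi : P i := ⟨le_rfl, by linarith [h0 (x i) (x j)]⟩
    have hle : i ≤ j - 1 := by omega
    have hP := Nat.findGreatest_spec hle hPi
    refine ⟨Nat.findGreatest P (j - 1), hP.1, ?_, hP.2, fun hlt => ?_⟩
    · have := Nat.findGreatest_le (P := P) (j - 1)
      omega
    · have hnot := Nat.findGreatest_is_greatest (P := P) (n := j - 1)
        (Nat.lt_succ_self _) (by omega)
      have h3 : ¬ D (x i) (x j) ≤ 2 * D (x (Nat.findGreatest P (j - 1) + 1)) (x j) :=
        fun h => hnot ⟨by have := hP.1; omega, h⟩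
      rcases le_total (D (x i) (x (Nat.findGreatest P (j - 1) + 1)))
        (D (x (Nat.findGreatest P (j - 1) + 1)) (x j)) with h | h
      · have := h2 (x i) (x j) (x (Nat.findGreatest P (j - 1) + 1))
        rw [max_eq_right h] at this
        exact absurd this h3
      · have := h2 (x i) (x j) (x (Nat.findGreatest P (j - 1) + 1))
        rwa [max_eq_left h] at this
  rw [hlast, hfirst]
  by_cases hA : r + 1 = j
  · have : r = j - 1 := by omega
    rw [this, hlast] at hr
    linarith [hf0 i]
  by_cases hB : r = i
  · have := hr' (by omega)
    rw [hB, hfirst] at this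
    linarith [hf0 (j - 1)]
  have e1 := ih (r + 1 - i) (by omega) i (r + 1) rfl (by omega)
  have e2 := ih (j - r) (by omega) r j rfl (by omega)
  have e3 := hr' (by omega)
  rw [hfirst, Finset.sum_Ico_succ_top hir] at e1
  rw [hlast, Finset.sum_eq_sum_Ico_succ_bot hrj] at e2
  have e4 : ∑ k ∈ Finset.Ico i j, f k
      = ∑ k ∈ Finset.Ico i r, f k + (f r + ∑ k ∈ Finset.Ico (r + 1) j, f k) := by
    rw [← Finset.sum_eq_sum_Ico_succ_bot hrj, Finset.sum_Ico_consecutive _ hir hrj.le]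
  simp only [Nat.add_sub_cancel] at e1
  rw [e4]
  simp only [hf] at *
  linarith

/-- The lengths of the chains from `x` to `y`. -/
def chainLengths (D : X → X → ℝ) (x y : X) : Set ℝ :=
  {S | ∃ (n : ℕ) (c : ℕ → X), c 0 = x ∧ c n = y ∧ S = ∑ k ∈ Finset.range n, D (c k) (c (k + 1))}

omit [MeasurableSpace X] in
theorem chainLengths_nonempty (D : X → X → ℝ) (x y : X) : (chainLengths D x y).Nonempty :=
  ⟨_, 1, fun k => if k = 0 then x else y, by simp, by simp, rfl⟩

omit [MeasurableSpace X] in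
theorem chainLengths_bddBelow {D : X → X → ℝ} (h0 : ∀ a b, 0 ≤ D a b) (x y : X) :
    BddBelow (chainLengths D x y) := by
  refine ⟨0, ?_⟩
  rintro S ⟨n, c, -, -, rfl⟩
  exact Finset.sum_nonneg fun k _ => h0 _ _

omit [MeasurableSpace X] in
theorem le_four_mul_sInf_chainLengths {D : X → X → ℝ} (h0 : ∀ a b, 0 ≤ D a b)
    (hself : ∀ a, D a a = 0) (h2 : ∀ a b c, D a b ≤ 2 * max (D a c) (D c b)) (x y : X) :
    D x y ≤ 4 * sInf (chainLengths D x y) := by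
  suffices D x y / 4 ≤ sInf (chainLengths D x y) by linarith
  refine le_csInf (chainLengths_nonempty D x y) ?_
  rintro S ⟨n, c, hx, hy, rfl⟩
  rcases Nat.lt_or_ge n 2 with hn | hn
  · interval_cases n
    · simp [← hx, ← hy, hself]
    · simp only [Finset.range_one, Finset.sum_singleton, zero_add, hx, hy]
      linarith [h0 x y]
  · have := frink_chain h0 h2 c n 0 n (by omega) (by omega)
    rw [← Finset.range_eq_Ico, hx, hy] at this
    linarith [h0 x (c (0 + 1)), h0 (c (n - 1)) y]

omit [MeasurableSpace X] in
theorem sInf_chainLengths_le_add {D : X → X → ℝ} (h0 : ∀ a b, 0 ≤ D a b) (x y z : X) :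
    sInf (chainLengths D x z) ≤ sInf (chainLengths D x y) + D y z := by
  suffices sInf (chainLengths D x z) - D y z ≤ sInf (chainLengths D x y) by linarith
  refine le_csInf (chainLengths_nonempty D x y) ?_
  rintro S ⟨n, c, hx, hy, rfl⟩
  rw [sub_le_iff_le_add]
  refine csInf_le (chainLengths_bddBelow h0 x z)
    ⟨n + 1, fun k => if k ≤ n then c k else z, by simp [hx], by simp, ?_⟩
  rw [Finset.sum_range_succ]
  congr 1
  · refine Finset.sum_congr rfl fun k hk => ?_
    have := Finset.mem_range.1 hk
    simp [this.le, Nat.succ_le_of_lt this]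
  · simp [hy]

omit [MeasurableSpace X] in
theorem Crho_mem {ϱ : X → X → ℝ} (hϱ : IsQuasiDist ϱ) :
    1 ≤ Crho ϱ ∧ ∀ x y z : X, ϱ x y ≤ Crho ϱ * max (ϱ x z) (ϱ z y) := by
  obtain ⟨-, -, -, C, hC⟩ := hϱ
  have hclosed : IsClosed {C : ℝ | 1 ≤ C ∧ ∀ x y z : X, ϱ x y ≤ C * max (ϱ x z) (ϱ z y)} := by
    simp only [Set.ofPred_and, Set.ofPred_forall]
    refine isClosed_Ici.inter ?_
    refine isClosed_iInter fun x => isClosed_iInter fun y => isClosed_iInter fun z => ?_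
    exact isClosed_le continuous_const (by fun_prop)
  exact hclosed.csInf_mem ⟨C, hC⟩ ⟨1, fun c hc => hc.1⟩

omit [MeasurableSpace X] in
/-- Below the index, `ρ ^ β` is comparable to a genuine distance for some `β > s`. -/
theorem exists_holder_gauge {ρ : X → X → ℝ} {s : ℝ} (hs : 0 < s) (hρ : IsQuasiDist ρ)
    (hind : SLtIndex ρ s) :
    ∃ β K : ℝ, s < β ∧ 1 ≤ K ∧ ∀ x, ∃ h : X → ℝ, h x = 0 ∧ (∀ y, ρ x y ^ β ≤ K * h y) ∧
      ∀ y z, |h y - h z| ≤ K * ρ y z ^ β := by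
  obtain ⟨ϱ, hϱ, ⟨c, hc1, hc⟩, hlt⟩ := hind
  obtain ⟨hC1, hC⟩ := Crho_mem hϱ
  set C := Crho ϱ
  obtain ⟨β, hsβ, hβ⟩ : ∃ β, s < β ∧ C ^ β < 2 := by
    have hcont : Continuous fun t : ℝ => C ^ t := Real.continuous_const_rpow (by positivity)
    have := hcont.continuousAt.eventually_lt (g := fun _ => (2 : ℝ)) (x₀ := s)
      continuousAt_const hlt
    have h3 := (this.filter_mono nhdsWithin_le_nhds).and (self_mem_nhdsWithin (s := Set.Ioi s))
    obtain ⟨β, h1, h2⟩ := h3.exists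
    exact ⟨β, h2, h1⟩
  have hβ0 : 0 < β := hs.trans hsβ
  obtain ⟨ρ0, ρz, ⟨C₀, hC₀1, hC₀⟩, -⟩ := hρ
  obtain ⟨ϱ0, ϱz, -, -⟩ := hϱ
  set m : X → X → ℝ := fun a b => max (ϱ a b) (ϱ b a) with hm
  have m0 : ∀ a b, 0 ≤ m a b := fun a b => le_max_of_le_left (ϱ0 a b)
  have mC : ∀ a b e, m a b ≤ C * max (m a e) (m e b) := by
    intro a b e
    refine max_le ((hC a b e).trans ?_) ((hC b a e).trans ?_)
    · gcongr
      · exact le_max_left _ _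
      · exact le_max_left _ _
    · rw [max_comm]
      gcongr
      · exact le_max_right _ _
      · exact le_max_right _ _
  set D : X → X → ℝ := fun a b => m a b ^ β with hD
  have D0 : ∀ a b, 0 ≤ D a b := fun a b => Real.rpow_nonneg (m0 a b) _
  have Dself : ∀ a, D a a = 0 := fun a => by
    simp [hD, hm, (ϱz a a).2 rfl, Real.zero_rpow hβ0.ne']
  have Dsymm : ∀ a b, D a b = D b a := fun a b => by simp only [hD, hm, max_comm]
  have D2 : ∀ a b e, D a b ≤ 2 * max (D a e) (D e b) := by
    intro a b e
    have h1 : D a b ≤ (C * max (m a e) (m e b)) ^ β :=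
      Real.rpow_le_rpow (m0 a b) (mC a b e) hβ0.le
    have h2 : (max (m a e) (m e b)) ^ β ≤ max (D a e) (D e b) := by
      rcases max_choice (m a e) (m e b) with h | h <;> rw [h]
      · exact le_max_left _ _
      · exact le_max_right _ _
    rw [Real.mul_rpow (by positivity) (le_max_of_le_left (m0 a e))] at h1
    refine h1.trans (mul_le_mul hβ.le h2 ?_ (by norm_num))
    exact Real.rpow_nonneg (le_max_of_le_left (m0 a e)) _
  have hDle : ∀ a b, D a b ≤ (c * C₀) ^ β * ρ a b ^ β := by
    intro a b
    rw [← Real.mul_rpow (by positivity) (ρ0 a b)]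
    refine Real.rpow_le_rpow (m0 a b) ?_ hβ0.le
    have key : ∀ a b, ϱ a b ≤ c * ρ a b := fun a b => by
      have := (hc a b).1
      rwa [inv_mul_le_iff₀ (by positivity)] at this
    refine max_le ((key a b).trans ?_) ((key b a).trans ?_)
    · have := ρ0 a b
      rw [mul_assoc]
      gcongr
      nlinarith
    · rw [mul_assoc]
      gcongr
      exact hC₀ a b
  have hleD : ∀ a b, ρ a b ^ β ≤ c ^ β * D a b := by
    intro a b
    rw [← Real.mul_rpow (by positivity) (m0 a b)]
    refine Real.rpow_le_rpow (ρ0 a b) ((hc a b).2.trans ?_) hβ0.le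
    gcongr
    exact le_max_left _ _
  have hcβ : 1 ≤ c ^ β := Real.one_le_rpow hc1 hβ0.le
  have hC₀β : 1 ≤ C₀ ^ β := Real.one_le_rpow hC₀1 hβ0.le
  have hK1 : (c * C₀) ^ β ≤ 4 * (c * C₀) ^ β := by
    have : 0 ≤ (c * C₀) ^ β := by positivity
    linarith
  have hK2 : 4 * c ^ β ≤ 4 * (c * C₀) ^ β := by
    rw [Real.mul_rpow (by positivity) (by positivity)]
    nlinarith
  refine ⟨β, 4 * (c * C₀) ^ β, hsβ, by linarith, fun x =>
    ⟨fun y => sInf (chainLengths D x y), ?_, fun y => ?_, fun y z => ?_⟩⟩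
  · have h1 := le_four_mul_sInf_chainLengths D0 Dself D2 x x
    have h2 : sInf (chainLengths D x x) ≤ 0 :=
      csInf_le (chainLengths_bddBelow D0 x x) ⟨0, fun _ => x, rfl, rfl, by simp⟩
    rw [Dself] at h1
    show sInf (chainLengths D x x) = 0
    linarith
  · have h1 := le_four_mul_sInf_chainLengths D0 Dself D2 x y
    have h2 : 0 ≤ sInf (chainLengths D x y) := by linarith [D0 x y]
    calc ρ x y ^ β ≤ c ^ β * D x y := hleD x y
      _ ≤ c ^ β * (4 * sInf (chainLengths D x y)) := by gcongr
      _ = 4 * c ^ β * sInf (chainLengths D x y) := by ring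
      _ ≤ _ := by gcongr
  · have h1 := sInf_chainLengths_le_add D0 x y z
    have h2 := sInf_chainLengths_le_add D0 x z y
    rw [Dsymm z y] at h2
    have h3 : D y z ≤ 4 * (c * C₀) ^ β * ρ y z ^ β :=
      (hDle y z).trans (mul_le_mul_of_nonneg_right hK1 (Real.rpow_nonneg (ρ0 y z) _))
    rw [abs_le]
    constructor <;> linarith

theorem IsQMMS.sigmaFinite {ρ : X → X → ℝ} {μ : Measure X} (hX : IsQMMS ρ μ) :
    SigmaFinite μ := by
  obtain ⟨x₀, -⟩ := hX.nontrivial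
  refine ⟨⟨⟨fun n : ℕ => qball ρ x₀ (n + 1), fun _ => trivial,
    fun n => hX.ball_lt_top _ _ (by positivity), ?_⟩⟩⟩
  refine eq_univ_of_forall fun y => mem_iUnion.2 ?_
  obtain ⟨n, hn⟩ := exists_nat_gt (ρ x₀ y)
  exact ⟨n, hn.trans (lt_add_one _)⟩

theorem IsQMMS.exists_countable_net {ρ : X → X → ℝ} {μ : Measure X} (hX : IsQMMS ρ μ) {ε : ℝ}
    (hε : 0 < ε) : ∃ S : Set X, S.Countable ∧ ∀ y, ∃ z ∈ S, ρ z y < ε := by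
  have := hX.sigmaFinite
  obtain ⟨-, ρz, ⟨C₀, hC₀1, hC₀⟩, ⟨C₁, hC₁1, hC₁⟩⟩ := hX.quasi
  set δ := ε / C₀ with hδ
  have hδ0 : 0 < δ := by positivity
  have hδε : C₀ * δ = ε := by rw [hδ]; field_simp
  have hδε' : δ ≤ ε := by nlinarith
  obtain ⟨S, hS⟩ := zorn_subset {S : Set X | S.Pairwise fun a b => δ ≤ ρ a b} (by
    intro c hc hchain
    exact ⟨⋃₀ c, (Set.pairwise_sUnion hchain.directedOn).2 fun s hs => hc hs,
      fun s hs => subset_sUnion_of_mem hs⟩)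
  refine ⟨S, ?_, fun y => ?_⟩
  · set η := δ / (C₁ * C₀) with hη
    have hη0 : 0 < η := by positivity
    have hηδ : C₁ * (C₀ * η) = δ := by rw [hη]; field_simp
    have hdisj : Pairwise (Function.onFun Disjoint fun a : S => qball ρ (a : X) η) := by
      intro a b hab
      refine Set.disjoint_left.2 fun w ha hb => ?_
      have h1 : δ ≤ ρ a b := hS.prop a.2 b.2 fun h => hab (Subtype.ext h)
      have h2 : ρ a w < η := ha
      have h3 : ρ b w < η := hb
      have h4 : max (ρ a w) (ρ w b) < C₀ * η :=
        max_lt (by nlinarith) ((hC₀ _ _).trans_lt (by gcongr))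
      have h5 := hC₁ a b w
      nlinarith
    have hcount := Measure.countable_meas_pos_of_disjoint_iUnion (μ := μ)
      (fun a : S => hX.measurableSet_ball (a : X) η hη0) hdisj
    have huniv : {a : S | 0 < μ (qball ρ (a : X) η)} = univ :=
      eq_univ_of_forall fun a => hX.ball_pos _ _ hη0
    rw [huniv, countable_univ_iff] at hcount
    exact hcount
  · by_contra! hfar
    have hyS : y ∉ S := fun hy => by
      have := hfar y hy
      rw [(ρz y y).2 rfl] at this
      linarith
    have hins : (insert y S).Pairwise fun a b => δ ≤ ρ a b := by
      refine (Set.pairwise_insert_of_notMem hyS).2 ⟨hS.prop, fun b hb => ⟨?_, ?_⟩⟩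
      · have h1 := hfar b hb
        have h2 := hC₀ y b
        nlinarith
      · exact hδε'.trans (hfar b hb)
    exact hyS (hS.le_of_ge hins (subset_insert y S) (mem_insert y S))

/-- Hölder functions on a quasi-metric measure space are measurable. -/
theorem IsQMMS.measurable_of_holder {ρ : X → X → ℝ} {μ : Measure X} (hX : IsQMMS ρ μ)
    {h : X → ℝ} {β K : ℝ} (hβ : 0 < β) (hK : 0 ≤ K)
    (hh : ∀ y z, |h y - h z| ≤ K * ρ y z ^ β) : Measurable h := by
  choose S hS hnet using fun n : ℕ => hX.exists_countable_net
    (ε := 1 / ((n : ℝ) + 1)) (by positivity)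
  have ρ0 := hX.quasi.1
  have hlip : ∀ (n : ℕ) z y, ρ z y < 1 / ((n : ℝ) + 1) →
      |h z - h y| ≤ K * (1 / ((n : ℝ) + 1)) ^ β := fun n z y hzy =>
    (hh z y).trans (by gcongr; exact ρ0 z y)
  refine measurable_of_Iio fun t => ?_
  have hset : h ⁻¹' Iio t = ⋃ n : ℕ, ⋃ z ∈ {z ∈ S n | h z + K * (1 / ((n : ℝ) + 1)) ^ β < t},
      qball ρ z (1 / ((n : ℝ) + 1)) := by
    ext y
    simp only [mem_preimage, mem_Iio, mem_iUnion, exists_prop]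
    constructor
    · intro hy
      have hlim : Filter.Tendsto (fun n : ℕ => 2 * K * (1 / ((n : ℝ) + 1)) ^ β) Filter.atTop
          (nhds 0) := by
        have := (tendsto_one_div_add_atTop_nhds_zero_nat (𝕜 := ℝ)).rpow_const
          (p := β) (Or.inr hβ.le)
        rw [Real.zero_rpow hβ.ne'] at this
        simpa using this.const_mul (2 * K)
      obtain ⟨n, hn⟩ := (hlim.eventually_lt_const (sub_pos.2 hy)).exists
      obtain ⟨z, hz, hzy⟩ := hnet n y
      refine ⟨n, z, ⟨hz, ?_⟩, hzy⟩
      have := abs_le.1 (hlip n z y hzy)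
      linarith
    · rintro ⟨n, z, ⟨-, hz⟩, hzy⟩
      have := abs_le.1 (hlip n z y hzy)
      linarith
  rw [hset]
  exact MeasurableSet.iUnion fun n => MeasurableSet.biUnion ((hS n).mono (sep_subset _ _))
    fun z _ => hX.measurableSet_ball _ _ (by positivity)

theorem lpN_indicator_const (ν : Measure X) {p : ℝ} (hp : 0 < p) {T : Set X}
    (hT : MeasurableSet T) (c : ℝ) :
    lpN ν p (fun x => ENNReal.ofReal (T.indicator (fun _ => c) x)) =
      ENNReal.ofReal c * ν T ^ (1 / p) := by
  have h : (fun x => ENNReal.ofReal (T.indicator (fun _ => c) x) ^ p)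
      = T.indicator fun _ => ENNReal.ofReal c ^ p := by
    ext x
    by_cases hx : x ∈ T <;> simp [hx, hp]
  rw [lpN, h, lintegral_indicator_const hT, ENNReal.mul_rpow_of_nonneg _ _ (by positivity),
    ← ENNReal.rpow_mul, mul_one_div_cancel hp.ne', ENNReal.rpow_one]

theorem lpN_mono {ν : Measure X} {p : ℝ} (hp : 0 < p) {f g : X → ℝ≥0∞} (h : ∀ x, f x ≤ g x) :
    lpN ν p f ≤ lpN ν p g := by
  unfold lpN
  gcongr
  exact h _

theorem lqN_const_mul {q : ℝ≥0∞} (hq : 0 < q) (c : ℝ≥0∞) (a : ℤ → ℝ≥0∞) :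
    lqN q (fun k => c * a k) = c * lqN q a := by
  unfold lqN
  split_ifs with h
  · rw [ENNReal.mul_iSup]
  · have hq' : 0 < q.toReal := ENNReal.toReal_pos hq.ne' h
    simp_rw [ENNReal.mul_rpow_of_nonneg _ _ hq'.le]
    rw [ENNReal.tsum_mul_left, ENNReal.mul_rpow_of_nonneg _ _ (by positivity),
      ← ENNReal.rpow_mul, mul_one_div_cancel hq'.ne', ENNReal.rpow_one]

theorem lqN_comp_sub (q : ℝ≥0∞) (a : ℤ → ℝ≥0∞) (n : ℤ) :
    lqN q (fun k => a (k - n)) = lqN q a := by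
  unfold lqN
  split_ifs with h
  · exact (Equiv.subRight n).iSup_comp (g := a)
  · congr 1
    exact (Equiv.subRight n).tsum_eq fun k => a k ^ q.toReal

theorem le_lqN {q : ℝ≥0∞} (hq : 0 < q) (a : ℤ → ℝ≥0∞) (k : ℤ) : a k ≤ lqN q a := by
  unfold lqN
  split_ifs with h
  · exact le_iSup a k
  · have hq' : 0 < q.toReal := ENNReal.toReal_pos hq.ne' h
    rw [one_div, ENNReal.le_rpow_inv_iff hq']
    exact ENNReal.le_tsum (f := fun k => a k ^ q.toReal) k

/-- The two-sided geometric sequence `2 ^ (-ε |k|)`. -/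
def twoSidedGeom (ε : ℝ) (k : ℤ) : ℝ := (2 : ℝ) ^ (-(ε * |(k : ℝ)|))

theorem lqN_twoSidedGeom_ne_top {q : ℝ≥0∞} (hq : 0 < q) {ε : ℝ} (hε : 0 < ε) :
    lqN q (fun k => ENNReal.ofReal (twoSidedGeom ε k)) ≠ ∞ := by
  unfold lqN
  split_ifs with h
  · refine ne_top_of_le_ne_top ENNReal.one_ne_top (iSup_le fun k => ?_)
    rw [← ENNReal.ofReal_one]
    refine ENNReal.ofReal_le_ofReal (Real.rpow_le_one_of_one_le_of_nonpos (by norm_num) ?_)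
    have : 0 ≤ ε * |(k : ℝ)| := by positivity
    linarith
  · have hq' : 0 < q.toReal := ENNReal.toReal_pos hq.ne' h
    refine ENNReal.rpow_ne_top_of_nonneg (by positivity) ?_
    have hterm : ∀ k : ℤ, ENNReal.ofReal (twoSidedGeom ε k) ^ q.toReal
        = ENNReal.ofReal ((2 : ℝ) ^ (-(ε * q.toReal * |(k : ℝ)|))) := fun k => by
      rw [twoSidedGeom, ENNReal.ofReal_rpow_of_pos (by positivity), ← Real.rpow_mul (by norm_num)]
      congr 2
      ring
    simp_rw [hterm]
    have hgeom : Summable fun n : ℕ => ((2 : ℝ) ^ (-(ε * q.toReal))) ^ n :=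
      summable_geometric_of_lt_one (by positivity)
        (Real.rpow_lt_one_of_one_lt_of_neg (by norm_num) (by
          have : 0 < ε * q.toReal := by positivity
          linarith))
    have hnat : Summable fun n : ℕ => (2 : ℝ) ^ (-(ε * q.toReal * (n : ℝ))) := by
      refine hgeom.congr fun n => ?_
      rw [← Real.rpow_natCast, ← Real.rpow_mul (by norm_num)]
      congr 1
      ring
    refine Summable.tsum_ofReal_ne_top (Summable.of_nat_of_neg ?_ ?_) <;>
      simpa using hnat

/-- The cut-off in the values of `h`, equal to `1` where `h ≤ a` and to `0` where `b ≤ h`. -/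
def cutoff (h : X → ℝ) (a b : ℝ) (y : X) : ℝ := max 0 (min 1 ((b - h y) / (b - a)))

omit [MeasurableSpace X] in
theorem cutoff_eq_one {h : X → ℝ} {a b : ℝ} (hab : a < b) {y : X} (hy : h y ≤ a) :
    cutoff h a b y = 1 := by
  have : 1 ≤ (b - h y) / (b - a) := by
    rw [one_le_div (by linarith)]
    linarith
  simp [cutoff, this]

omit [MeasurableSpace X] in
theorem cutoff_eq_zero {h : X → ℝ} {a b : ℝ} (hab : a < b) {y : X} (hy : b ≤ h y) :
    cutoff h a b y = 0 := by
  have : (b - h y) / (b - a) ≤ 0 := div_nonpos_of_nonpos_of_nonneg (by linarith) (by linarith)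
  simp [cutoff, this]

omit [MeasurableSpace X] in
theorem cutoff_mem_Icc (h : X → ℝ) (a b : ℝ) (y : X) : cutoff h a b y ∈ Icc (0 : ℝ) 1 :=
  ⟨le_max_left _ _, max_le zero_le_one (min_le_left _ _)⟩

omit [MeasurableSpace X] in
theorem abs_cutoff_sub_le_one (h : X → ℝ) (a b : ℝ) (y z : X) :
    |cutoff h a b y - cutoff h a b z| ≤ 1 := by
  have h1 := cutoff_mem_Icc h a b y
  have h2 := cutoff_mem_Icc h a b z
  rw [abs_le]
  constructor <;> linarith [h1.1, h1.2, h2.1, h2.2]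

omit [MeasurableSpace X] in
theorem abs_cutoff_sub_le (h : X → ℝ) {a b : ℝ} (hab : a < b) (y z : X) :
    |cutoff h a b y - cutoff h a b z| ≤ |h y - h z| / (b - a) := by
  have h1 : |cutoff h a b y - cutoff h a b z| ≤ |(b - h y) / (b - a) - (b - h z) / (b - a)| := by
    unfold cutoff
    refine (abs_max_sub_max_le_max _ _ _ _).trans (max_le (by simp) ?_)
    exact (abs_min_sub_min_le_max _ _ _ _).trans (max_le (by simp) le_rfl)
  refine h1.trans (le_of_eq ?_)
  rw [← sub_div, abs_div, abs_of_pos (sub_pos.2 hab),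
    show b - h y - (b - h z) = -(h y - h z) by ring, abs_neg]

/-- The oscillation of a cut-off of a Hölder function with transition width `w ^ β ≈ 2 ^ (-n β)`
at distances comparable to `2 ^ (-k)`. -/
theorem cutoff_fracGrad_bound {s β K Δ t d : ℝ} (hs : 0 < s) (hsβ : s < β) (hK : 1 ≤ K)
    {n k : ℤ} (hΔ : (2 : ℝ) ^ (-(n * β)) ≤ Δ) (hd1 : (2 : ℝ) ^ (-k - 1) ≤ d)
    (hd2 : d < (2 : ℝ) ^ (-k)) (ht1 : t ≤ 1) (ht2 : t ≤ K * d ^ β / Δ) :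
    t ≤ d ^ s * (K * 2 ^ s * 2 ^ (n * s) * twoSidedGeom (min s (β - s)) (k - n)) := by
  have hd0 : 0 < d := lt_of_lt_of_le (by positivity) hd1
  have hΔ0 : 0 < Δ := lt_of_lt_of_le (by positivity) hΔ
  have hd1' : (2 : ℝ) ^ (-(k : ℝ) - 1) ≤ d := by
    rw [← Real.rpow_intCast] at hd1
    exact_mod_cast hd1
  have hd2' : d ≤ (2 : ℝ) ^ (-(k : ℝ)) := by
    rw [← Real.rpow_intCast] at hd2
    exact_mod_cast hd2.le
  have h2s : (1 : ℝ) ≤ 2 ^ s := Real.one_le_rpow (by norm_num) hs.le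
  rcases le_total k n with hkn | hkn
  · have hkn' : (k : ℝ) ≤ n := by exact_mod_cast hkn
    have e1 : (2 : ℝ) ^ (-((k : ℝ) + 1) * s) ≤ d ^ s := by
      rw [Real.rpow_mul (by norm_num)]
      refine Real.rpow_le_rpow (by positivity) (le_trans (le_of_eq ?_) hd1') hs.le
      congr 1; ring
    have e2 : (2 : ℝ) ^ (-(s * (n - k : ℝ))) ≤ twoSidedGeom (min s (β - s)) (k - n) := by
      unfold twoSidedGeom
      refine Real.rpow_le_rpow_of_exponent_le (by norm_num) ?_
      push_cast
      rw [abs_sub_comm, abs_of_nonneg (by linarith)]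
      have := mul_le_mul_of_nonneg_right (min_le_left s (β - s)) (sub_nonneg.2 hkn')
      linarith
    calc t ≤ 1 := ht1
      _ ≤ K := hK
      _ = (2 : ℝ) ^ (-((k : ℝ) + 1) * s) *
          (K * 2 ^ s * 2 ^ (n * s) * 2 ^ (-(s * (n - k : ℝ)))) := by
        have : (2 : ℝ) ^ (-((k : ℝ) + 1) * s) * 2 ^ s * 2 ^ (n * s) * 2 ^ (-(s * (n - k : ℝ)))
            = 1 := by
          rw [← Real.rpow_add (by norm_num), ← Real.rpow_add (by norm_num),
            ← Real.rpow_add (by norm_num)]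
          convert Real.rpow_zero (2 : ℝ) using 2
          ring
        linear_combination (-K) * this
      _ ≤ _ := by gcongr
  · have hkn' : (n : ℝ) ≤ k := by exact_mod_cast hkn
    have e2 : (2 : ℝ) ^ (-((β - s) * (k - n : ℝ))) ≤ twoSidedGeom (min s (β - s)) (k - n) := by
      unfold twoSidedGeom
      refine Real.rpow_le_rpow_of_exponent_le (by norm_num) ?_
      push_cast
      rw [abs_of_nonneg (by linarith)]
      have := mul_le_mul_of_nonneg_right (min_le_right s (β - s)) (sub_nonneg.2 hkn')
      linarith
    have e3 : d ^ (β - s) ≤ (2 : ℝ) ^ (-(k : ℝ) * (β - s)) := by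
      rw [Real.rpow_mul (by norm_num)]
      exact Real.rpow_le_rpow hd0.le hd2' (by linarith)
    have e4 : d ^ β = d ^ s * d ^ (β - s) := by
      rw [← Real.rpow_add hd0]; congr 1; ring
    calc t ≤ K * d ^ β / Δ := ht2
      _ ≤ K * d ^ β / (2 : ℝ) ^ (-(n * β)) := by gcongr
      _ = d ^ s * (K * (2 : ℝ) ^ (n * β) * d ^ (β - s)) := by
        rw [e4, Real.rpow_neg (by norm_num), div_inv_eq_mul]
        ring
      _ ≤ d ^ s * (K * (2 : ℝ) ^ (n * β) * (2 : ℝ) ^ (-(k : ℝ) * (β - s))) := by gcongr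
      _ = d ^ s * (K * 1 * 2 ^ (n * s) * 2 ^ (-((β - s) * (k - n : ℝ)))) := by
        have : (2 : ℝ) ^ (n * β) * (2 : ℝ) ^ (-(k : ℝ) * (β - s))
            = 2 ^ (n * s) * 2 ^ (-((β - s) * (k - n : ℝ))) := by
          rw [← Real.rpow_add (by norm_num), ← Real.rpow_add (by norm_num)]
          congr 1; ring
        linear_combination (d ^ s * K) * this
      _ ≤ _ := by gcongr

/-- The `N^s_{p,q}`-norm of a cut-off of a Hölder function of order `β > s`. -/
theorem exists_NNorm_cutoff_le {s β K p : ℝ} {q : ℝ≥0∞} (hs : 0 < s) (hsβ : s < β) (hK : 1 ≤ K)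
    (hp : 0 < p) (hq : 0 < q) :
    ∃ C : ℝ, 0 < C ∧ ∀ (ρ : X → X → ℝ) (μ : Measure X) (Ω : Set X) (h : X → ℝ) (a b : ℝ),
      Measurable h → (∀ y z, |h y - h z| ≤ K * ρ y z ^ β) → a < b → b - a ≤ 1 →
      μ.restrict Ω {y | h y < b} ≠ ∞ →
      MemNspq ρ μ Ω s p q (cutoff h a b) ∧
        NNorm ρ μ Ω s p q (cutoff h a b) ≤
          ENNReal.ofReal (C * (b - a) ^ (-(s / β))) *
            μ.restrict Ω {y | h y < b} ^ (1 / p) := by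
  set ε := min s (β - s) with hε
  have hε0 : 0 < ε := lt_min hs (by linarith)
  set L := lqN q (fun k => ENNReal.ofReal (twoSidedGeom ε k)) with hL
  have hLtop : L ≠ ∞ := lqN_twoSidedGeom_ne_top hq hε0
  have hβ : 0 < β := hs.trans hsβ
  refine ⟨K * 2 ^ s * 2 ^ s * L.toReal + 1, by positivity, ?_⟩
  intro ρ μ Ω h a b hmeas hh hab hab1 hfin
  set Δ := b - a with hΔ
  have hΔ0 : 0 < Δ := sub_pos.2 hab
  set T : Set X := {y | h y < b} with hT
  have hTm : MeasurableSet T := measurableSet_lt hmeas measurable_const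
  have hum : Measurable (cutoff h a b) :=
    measurable_const.max (measurable_const.min ((measurable_const.sub hmeas).div_const _))
  have hlp : lpOn μ Ω p (cutoff h a b) ≤ μ.restrict Ω T ^ (1 / p) := by
    have := lpN_indicator_const (μ.restrict Ω) hp hTm 1
    rw [ENNReal.ofReal_one, one_mul] at this
    rw [← this]
    refine lpN_mono hp fun y => ENNReal.ofReal_le_ofReal ?_
    by_cases hy : y ∈ T
    · have := cutoff_mem_Icc h a b y
      rw [indicator_of_mem hy, abs_of_nonneg this.1]
      exact this.2
    · rw [indicator_of_notMem hy, cutoff_eq_zero hab (not_lt.1 hy), abs_zero]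
  obtain ⟨m, hm1, hm2⟩ := exists_mem_Ico_zpow (x := Δ ^ (1 / β)) (y := (2 : ℝ))
    (by positivity) (by norm_num)
  obtain ⟨n, rfl⟩ : ∃ n : ℤ, m = -n := ⟨-m, by ring⟩
  have hn1 : (2 : ℝ) ^ (-(n * β)) ≤ Δ := by
    have := Real.rpow_le_rpow (by positivity) hm1 hβ.le
    rw [← Real.rpow_mul hΔ0.le, one_div_mul_cancel hβ.ne', Real.rpow_one, ← Real.rpow_intCast,
      ← Real.rpow_mul (by norm_num)] at this
    push_cast at this
    rwa [neg_mul] at this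
  have hn2 : (2 : ℝ) ^ (n * s) ≤ 2 ^ s * Δ ^ (-(s / β)) := by
    have := Real.rpow_le_rpow (by positivity) hm2.le hs.le
    rw [← Real.rpow_mul hΔ0.le, ← Real.rpow_intCast, ← Real.rpow_mul (by norm_num)] at this
    push_cast at this
    have h3 : (2 : ℝ) ^ ((-(n : ℝ) + 1) * s) = 2 ^ s * (2 ^ (n * s))⁻¹ := by
      rw [← Real.rpow_neg (by norm_num), ← Real.rpow_add (by norm_num)]
      congr 1; ring
    rw [h3] at this
    rw [Real.rpow_neg hΔ0.le, show s / β = 1 / β * s by ring, ← div_eq_mul_inv,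
      le_div_iff₀ (by positivity)]
    rwa [← div_eq_mul_inv, le_div_iff₀ (by positivity), mul_comm] at this
  set A : ℝ := K * 2 ^ s * 2 ^ (n * s) with hA
  have hA0 : 0 ≤ A := by positivity
  set g : ℤ → X → ℝ := fun k => T.indicator fun _ => A * twoSidedGeom ε (k - n) with hg
  have htg : ∀ k, 0 ≤ twoSidedGeom ε k := fun k => by unfold twoSidedGeom; positivity
  have hg0 : ∀ k y, 0 ≤ g k y := fun k y => indicator_nonneg (fun _ _ => mul_nonneg hA0 (htg _)) y
  have hgrad : g ∈ fracGrad ρ μ Ω s (cutoff h a b) := by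
    refine ⟨hg0, fun k => (measurable_const.indicator hTm).aemeasurable, ∅, measure_empty, ?_⟩
    intro k y _ z _ hd1 hd2
    have hd0 : 0 < ρ y z := lt_of_lt_of_le (by positivity) hd1
    have hosc := cutoff_fracGrad_bound hs hsβ hK hn1 hd1 hd2 (abs_cutoff_sub_le_one h a b y z)
      ((abs_cutoff_sub_le h hab y z).trans (by gcongr; exact hh y z))
    by_cases hy : y ∈ T
    · refine hosc.trans ?_
      have : g k y = A * twoSidedGeom ε (k - n) := indicator_of_mem hy _
      rw [this]
      have := hg0 k z
      gcongr
      linarith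
    by_cases hz : z ∈ T
    · refine hosc.trans ?_
      have : g k z = A * twoSidedGeom ε (k - n) := indicator_of_mem hz _
      rw [this]
      have := hg0 k y
      gcongr
      linarith
    · rw [cutoff_eq_zero hab (not_lt.1 hy), cutoff_eq_zero hab (not_lt.1 hz), sub_self, abs_zero]
      have := hg0 k y
      have := hg0 k z
      positivity
  have hdot : NdotNorm ρ μ Ω s p q (cutoff h a b) ≤
      ENNReal.ofReal (A * L.toReal) * μ.restrict Ω T ^ (1 / p) := by
    refine (iInf₂_le g hgrad).trans (le_of_eq ?_)
    simp only [hg, lpN_indicator_const _ hp hTm, ENNReal.ofReal_mul hA0]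
    have : ∀ k : ℤ, ENNReal.ofReal A * ENNReal.ofReal (twoSidedGeom ε (k - n)) *
        μ.restrict Ω T ^ (1 / p) = (ENNReal.ofReal A * μ.restrict Ω T ^ (1 / p)) *
          ENNReal.ofReal (twoSidedGeom ε (k - n)) := fun k => by ring
    simp_rw [this]
    rw [lqN_const_mul hq, lqN_comp_sub q (fun k => ENNReal.ofReal (twoSidedGeom ε k)),
      ← hL, ENNReal.ofReal_toReal hLtop]
    ring
  have hfin' : μ.restrict Ω T ^ (1 / p) ≠ ∞ :=
    ENNReal.rpow_ne_top_of_nonneg (by positivity) hfin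
  refine ⟨⟨hum.aemeasurable, ne_top_of_le_ne_top hfin' hlp,
    ne_top_of_le_ne_top (ENNReal.mul_ne_top ENNReal.ofReal_ne_top hfin') hdot⟩, ?_⟩
  calc NNorm ρ μ Ω s p q (cutoff h a b)
      ≤ ENNReal.ofReal (A * L.toReal) * μ.restrict Ω T ^ (1 / p) +
          ENNReal.ofReal 1 * μ.restrict Ω T ^ (1 / p) := by
        rw [ENNReal.ofReal_one, one_mul]
        exact add_le_add hdot hlp
    _ = ENNReal.ofReal (A * L.toReal + 1) * μ.restrict Ω T ^ (1 / p) := by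
        rw [ENNReal.ofReal_add (by positivity) zero_le_one, add_mul]
    _ ≤ _ := by
        gcongr
        have h1 : (1 : ℝ) ≤ Δ ^ (-(s / β)) :=
          Real.one_le_rpow_of_pos_of_le_one_of_nonpos hΔ0 hab1 (by
            have : 0 < s / β := by positivity
            linarith)
        have h2 : A * L.toReal ≤ K * 2 ^ s * (2 ^ s * Δ ^ (-(s / β))) * L.toReal := by
          rw [hA]; gcongr
        calc A * L.toReal + 1 ≤ K * 2 ^ s * (2 ^ s * Δ ^ (-(s / β))) * L.toReal
              + Δ ^ (-(s / β)) := add_le_add h2 h1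
          _ = _ := by ring

/-- A fractional `s`-gradient yields, at every scale `ε`, a single function controlling the
oscillation at distances less than `ε`. -/
theorem exists_scale_gradient {s p : ℝ} (hs : 0 < s) (hp : 0 < p) :
    ∃ c₀ : ℝ, 0 < c₀ ∧ ∀ (ρ : X → X → ℝ) (μ : Measure X) (v : X → ℝ) (g : ℤ → X → ℝ) (T : ℝ),
      (∀ x y, 0 ≤ ρ x y) → (∀ x y, ρ x y = 0 → x = y) → 0 ≤ T →
      g ∈ fracGrad ρ μ univ s v →
      (∀ k, lpN μ p (fun x => ENNReal.ofReal (g k x)) ≤ ENNReal.ofReal T) →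
      ∃ E : Set X, μ E = 0 ∧ ∀ ε : ℝ, 0 < ε → ∃ P : X → ℝ≥0∞, AEMeasurable P μ ∧
        ∫⁻ x, P x ∂μ ≤ ENNReal.ofReal (c₀ * ε ^ (s * p) * T ^ p) ∧
        ∀ y z, y ∉ E → z ∉ E → ρ y z < ε → ∀ w : ℝ, 0 ≤ w → P y ≤ ENNReal.ofReal w →
          P z ≤ ENNReal.ofReal w → |v y - v z| ≤ 2 * w ^ (1 / p) := by
  have hsp : 0 < s * p := by positivity
  set G : ℝ≥0∞ := ∑' j : ℕ, ENNReal.ofReal ((2 : ℝ) ^ (-(s * p))) ^ j with hG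
  have hGtop : G ≠ ∞ := by
    rw [hG, ENNReal.tsum_geometric]
    refine ENNReal.inv_ne_top.2 (tsub_pos_of_lt ?_).ne'
    rw [← ENNReal.ofReal_one]
    exact (ENNReal.ofReal_lt_ofReal_iff one_pos).2
      (Real.rpow_lt_one_of_one_lt_of_neg (by norm_num) (by linarith))
  obtain ⟨γ, hγ, hGγ⟩ : ∃ γ : ℝ, 0 ≤ γ ∧ G = ENNReal.ofReal γ :=
    ⟨G.toReal, ENNReal.toReal_nonneg, (ENNReal.ofReal_toReal hGtop).symm⟩
  refine ⟨2 ^ (s * p) * (γ + 1), by positivity, ?_⟩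
  intro ρ μ v g T ρ0 ρz hT ⟨hg0, hgm, E, hE, hg⟩ hgT
  refine ⟨E, hE, fun ε hε => ?_⟩
  obtain ⟨m, hm1, hm2⟩ := exists_mem_Ioc_zpow hε (one_lt_two (α := ℝ))
  obtain ⟨N, rfl⟩ : ∃ N : ℤ, m = -N - 1 := ⟨-m - 1, by ring⟩
  set a : ℕ → ℝ := fun j => (2 : ℝ) ^ (-((N + j : ℝ) * (s * p))) with ha
  refine ⟨fun x => ∑' j : ℕ, ENNReal.ofReal (a j) * ENNReal.ofReal (g (N + j) x) ^ p, ?_, ?_, ?_⟩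
  · refine AEMeasurable.tsum fun j => AEMeasurable.const_mul ?_ _
    have := hgm (N + j)
    rw [Measure.restrict_univ] at this
    exact this.ennreal_ofReal.pow_const _
  · rw [lintegral_tsum fun j => by
      have := hgm (N + j)
      rw [Measure.restrict_univ] at this
      exact (this.ennreal_ofReal.pow_const _).const_mul _]
    have hterm : ∀ j : ℕ, ∫⁻ x, ENNReal.ofReal (a j) * ENNReal.ofReal (g (N + j) x) ^ p ∂μ ≤
        ENNReal.ofReal ((2 : ℝ) ^ (-(N * (s * p)))) * ENNReal.ofReal (T ^ p) *
          ENNReal.ofReal ((2 : ℝ) ^ (-(s * p))) ^ j := by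
      intro j
      rw [lintegral_const_mul' _ _ ENNReal.ofReal_ne_top]
      have h1 : ∫⁻ x, ENNReal.ofReal (g (N + j) x) ^ p ∂μ ≤ ENNReal.ofReal (T ^ p) := by
        have := hgT (N + j)
        rw [lpN, one_div, ENNReal.rpow_inv_le_iff hp,
          ENNReal.ofReal_rpow_of_nonneg hT hp.le] at this
        exact this
      have h2 : a j = (2 : ℝ) ^ (-(N * (s * p))) * ((2 : ℝ) ^ (-(s * p))) ^ j := by
        rw [← Real.rpow_natCast, ← Real.rpow_mul (by norm_num), ← Real.rpow_add (by norm_num)]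
        simp only [ha]
        congr 1
        ring
      rw [h2, ENNReal.ofReal_mul (by positivity), ENNReal.ofReal_pow (by positivity)]
      calc _ ≤ ENNReal.ofReal ((2 : ℝ) ^ (-(N * (s * p)))) *
            ENNReal.ofReal ((2 : ℝ) ^ (-(s * p))) ^ j * ENNReal.ofReal (T ^ p) := by gcongr
        _ = _ := by ring
    refine (ENNReal.tsum_le_tsum hterm).trans ?_
    rw [ENNReal.tsum_mul_left, ← hG, hGγ, ← ENNReal.ofReal_mul (by positivity), ← ENNReal.ofReal_mul (by positivity)]
    refine ENNReal.ofReal_le_ofReal ?_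
    have h3 : (2 : ℝ) ^ (-(N * (s * p))) ≤ 2 ^ (s * p) * ε ^ (s * p) := by
      rw [← Real.mul_rpow (by norm_num) hε.le, ← neg_mul, Real.rpow_mul (by norm_num)]
      refine Real.rpow_le_rpow (by positivity) ?_ hsp.le
      rw [zpow_sub_one₀ (by norm_num), ← Real.rpow_intCast] at hm1
      push_cast at hm1
      linarith
    calc (2 : ℝ) ^ (-(N * (s * p))) * T ^ p * γ
        ≤ (2 ^ (s * p) * ε ^ (s * p)) * T ^ p * (γ + 1) := by
          gcongr
          linarith
      _ = _ := by ring
  · intro y z hy hz hyz w hw hPy hPz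
    rcases (ρ0 y z).eq_or_lt with h0 | h0
    · rw [ρz y z h0.symm, sub_self, abs_zero]
      positivity
    obtain ⟨l, hl1, hl2⟩ := exists_mem_Ico_zpow h0 (one_lt_two (α := ℝ))
    obtain ⟨k, rfl⟩ : ∃ k : ℤ, l = -k - 1 := ⟨-l - 1, by ring⟩
    rw [sub_add_cancel] at hl2 hm2
    have hNk : N ≤ k := by
      have : (2 : ℝ) ^ (-k - 1) < (2 : ℝ) ^ (-N) := hl1.trans_lt (hyz.trans_le hm2)
      rw [zpow_lt_zpow_iff_right₀ (one_lt_two (α := ℝ))] at this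
      omega
    obtain ⟨j, rfl⟩ : ∃ j : ℕ, k = N + j := ⟨(k - N).toNat, by omega⟩
    have hpt : ∀ u, ∑' j : ℕ, ENNReal.ofReal (a j) * ENNReal.ofReal (g (N + j) u) ^ p ≤
        ENNReal.ofReal w → (2 : ℝ) ^ (-((N + j : ℝ) * s)) * g (N + j) u ≤ w ^ (1 / p) := by
      intro u hu
      have h1 := (ENNReal.le_tsum (f := fun j : ℕ =>
        ENNReal.ofReal (a j) * ENNReal.ofReal (g (N + j) u) ^ p) j).trans hu
      rw [ENNReal.ofReal_rpow_of_nonneg (hg0 _ _) hp.le, ← ENNReal.ofReal_mul (by positivity),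
        ENNReal.ofReal_le_ofReal_iff hw] at h1
      rw [one_div, Real.le_rpow_inv_iff_of_pos (mul_nonneg (by positivity) (hg0 _ _)) hw hp,
        Real.mul_rpow (by positivity) (hg0 _ _), ← Real.rpow_mul (by norm_num)]
      convert h1 using 2
      simp only [ha]
      congr 1
      ring
    have h1 := hg (N + j) y ⟨mem_univ _, hy⟩ z ⟨mem_univ _, hz⟩ hl1 hl2
    have h2 : ρ y z ^ s ≤ (2 : ℝ) ^ (-((N + j : ℝ) * s)) := by
      rw [← neg_mul, Real.rpow_mul (by norm_num)]
      refine Real.rpow_le_rpow (ρ0 _ _) ?_ hs.le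
      rw [← Real.rpow_intCast] at hl2
      push_cast at hl2
      exact hl2.le
    have h3 : |v y - v z| ≤
        (2 : ℝ) ^ (-((N + j : ℝ) * s)) * (g (N + j) y + g (N + j) z) :=
      h1.trans (mul_le_mul_of_nonneg_right h2 (add_nonneg (hg0 _ _) (hg0 _ _)))
    linarith [hpt y hPy, hpt z hPz]

theorem exists_mem_le_of_lintegral_le {μ : Measure X} {P₁ P₂ : X → ℝ≥0∞}
    (hP₁ : AEMeasurable P₁ μ) (hP₂ : AEMeasurable P₂ μ) {i₁ i₂ a : ℝ} (hi₁ : 0 < i₁) (hi₂ : 0 < i₂)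
    (ha : 0 < a) (h₁ : ∫⁻ x, P₁ x ∂μ ≤ ENNReal.ofReal i₁) (h₂ : ∫⁻ x, P₂ x ∂μ ≤ ENNReal.ofReal i₂)
    {A E : Set X} (hA : ENNReal.ofReal a ≤ μ A) (hE : μ E = 0) :
    ∃ z ∈ A, z ∉ E ∧ P₁ z ≤ ENNReal.ofReal (3 * i₁ / a) ∧ P₂ z ≤ ENNReal.ofReal (3 * i₂ / a) := by
  have key : ∀ {P : X → ℝ≥0∞} {i : ℝ}, AEMeasurable P μ → 0 < i →
      ∫⁻ x, P x ∂μ ≤ ENNReal.ofReal i →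
      μ {x | ENNReal.ofReal (3 * i / a) ≤ P x} ≤ ENNReal.ofReal (a / 3) := by
    intro P i hP hi hint
    have hpos : 0 < 3 * i / a := by positivity
    refine (meas_ge_le_lintegral_div hP (ENNReal.ofReal_pos.2 hpos).ne'
      ENNReal.ofReal_ne_top).trans ((ENNReal.div_le_div_right hint _).trans (le_of_eq ?_))
    rw [← ENNReal.ofReal_div_of_pos hpos]
    congr 1
    field_simp
  by_contra! hcon
  have hsub : A ⊆ E ∪ ({x | ENNReal.ofReal (3 * i₁ / a) ≤ P₁ x} ∪
      {x | ENNReal.ofReal (3 * i₂ / a) ≤ P₂ x}) := by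
    intro z hz
    by_cases hzE : z ∈ E
    · exact Or.inl hzE
    by_cases hz1 : P₁ z ≤ ENNReal.ofReal (3 * i₁ / a)
    · exact Or.inr (Or.inr (hcon z hz hzE hz1).le)
    · exact Or.inr (Or.inl (not_le.1 hz1).le)
  have hle : ENNReal.ofReal a ≤ ENNReal.ofReal (a / 3 + a / 3) := by
    calc ENNReal.ofReal a ≤ μ A := hA
      _ ≤ _ := measure_mono hsub
      _ ≤ _ := measure_union_le _ _
      _ ≤ μ E + (_ + _) := by gcongr; exact measure_union_le _ _
      _ ≤ 0 + (ENNReal.ofReal (a / 3) + ENNReal.ofReal (a / 3)) := by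
        gcongr
        · exact hE.le
        · exact key hP₁ hi₁ h₁
        · exact key hP₂ hi₂ h₂
      _ = _ := by rw [zero_add, ENNReal.ofReal_add (by positivity) (by positivity)]
  rw [ENNReal.ofReal_le_ofReal_iff (by positivity)] at hle
  linarith

/-- A capacity-type lower bound: a function equal to `1` and to `0` on two subsets of a ball has
large `N^s_{p,∞}`-energy. -/
theorem IsQMMS.exists_capacity_bound {ρ : X → X → ℝ} {μ : Measure X} (hX : IsQMMS ρ μ)
    {Q s p : ℝ} (hQ : 0 < Q) (hdoub : QDoubling ρ μ Q) (hs : 0 < s) (hp : 0 < p) :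
    ∃ C : ℝ, 0 < C ∧ ∀ (v : X → ℝ) (g : ℤ → X → ℝ) (T : ℝ) (x : X) (r α : ℝ) (A A' : Set X),
      0 < T → g ∈ fracGrad ρ μ univ s v →
      (∀ k, lpN μ p (fun x => ENNReal.ofReal (g k x)) ≤ ENNReal.ofReal T) →
      0 < r → A ⊆ qball ρ x r → A' ⊆ qball ρ x r → (∀ y ∈ A, v y = 0) → (∀ y ∈ A', v y = 1) →
      0 < α → α ≤ μ.real (qball ρ x r) → ENNReal.ofReal α ≤ μ A → ENNReal.ofReal α ≤ μ A' →
      (α / μ.real (qball ρ x r)) ^ (Q / (s * p + Q)) ≤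
        C * (T ^ p * r ^ (s * p) / μ.real (qball ρ x r)) := by
  obtain ⟨c₀, hc₀, hscale⟩ := exists_scale_gradient (X := X) hs hp
  obtain ⟨ρ0, ρz, ⟨C₀, hC₀1, hC₀⟩, ⟨C₁, hC₁1, hC₁⟩⟩ := hX.quasi
  obtain ⟨κ, hκ, hdoub⟩ := hdoub
  have hsp : 0 < s * p := by positivity
  set C₂ := C₁ * (C₀ * C₁) with hC₂
  have hC₂1 : 1 ≤ C₂ := one_le_mul_of_one_le_of_one_le hC₁1
    (one_le_mul_of_one_le_of_one_le hC₀1 hC₁1)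
  set c₁ : ℝ := 3 * c₀ + 3 * c₀ * C₂ ^ (s * p) * C₁ ^ Q / κ with hc₁
  refine ⟨6 ^ p * c₁, by positivity, ?_⟩
  intro v g T x r α A A' hT hg hgT hr hA hA' hvA hvA' hα hαM hμA hμA'
  set M := μ.real (qball ρ x r) with hM
  have hM0 : 0 < M := hα.trans_le hαM
  obtain ⟨E, hE, hE'⟩ := hscale ρ μ v g T ρ0 (fun x y => (ρz x y).1) hT.le hg hgT
  set t := (α / M) ^ (1 / (s * p + Q)) with ht
  have ht0 : 0 < t := by positivity
  have ht1 : t ≤ 1 := Real.rpow_le_one (by positivity) (div_le_one_of_le₀ hαM hM0.le)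
    (by positivity)
  have htα : t ^ (s * p) * t ^ Q * M = α := by
    rw [← Real.rpow_add ht0, ht, ← Real.rpow_mul (by positivity),
      one_div_mul_cancel (by positivity), Real.rpow_one, div_mul_cancel₀ _ hM0.ne']
  have htQ : (α / M) ^ (Q / (s * p + Q)) = t ^ Q := by
    rw [ht, ← Real.rpow_mul (by positivity)]
    congr 1; ring
  have hε : 0 < t * r := by positivity
  obtain ⟨P₁, hP₁m, hP₁i, hP₁⟩ := hE' (t * r) hε
  obtain ⟨P₂, hP₂m, hP₂i, hP₂⟩ := hE' (C₂ * r) (by positivity)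
  set i₁ := c₀ * (t * r) ^ (s * p) * T ^ p with hi₁
  set i₂ := c₀ * (C₂ * r) ^ (s * p) * T ^ p with hi₂
  have hi₁0 : 0 < i₁ := by positivity
  have hi₂0 : 0 < i₂ := by positivity
  have hi₁₂ : i₁ ≤ i₂ := by rw [hi₁, hi₂]; gcongr; linarith
  set b := κ * (t / C₁) ^ Q * M with hb
  have hb0 : 0 < b := by positivity
  set W := T ^ p * r ^ (s * p) / (t ^ Q * M) with hW
  have hW0 : 0 < W := by positivity
  have hw₁ : 3 * i₁ / α = 3 * c₀ * W := by
    rw [hi₁, ← htα, hW, Real.mul_rpow ht0.le hr.le]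
    field_simp
  have hw₂ : 3 * i₂ / b = 3 * c₀ * C₂ ^ (s * p) * C₁ ^ Q / κ * W := by
    rw [hi₂, hb, hW, Real.mul_rpow (by positivity) hr.le, Real.div_rpow ht0.le (by positivity)]
    field_simp
  have hle₁ : 3 * i₁ / α ≤ c₁ * W := by
    rw [hw₁, hc₁]
    gcongr
    have : 0 ≤ 3 * c₀ * C₂ ^ (s * p) * C₁ ^ Q / κ := by positivity
    linarith
  have hle₂ : 3 * i₂ / b ≤ c₁ * W := by
    rw [hw₂, hc₁]
    gcongr
    linarith
  have hle₃ : 3 * i₁ / b ≤ c₁ * W := le_trans (by gcongr) hle₂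
  have hball : ∀ y ∈ qball ρ x r, qball ρ y (t * r) ⊆ qball ρ x (C₁ * r) := by
    intro y (hy : ρ x y < r) w (hw : ρ y w < t * r)
    refine (hC₁ x w y).trans_lt ?_
    have : max (ρ x y) (ρ y w) < r := max_lt hy (by nlinarith)
    gcongr
  have hbmeas : ∀ y ∈ qball ρ x r, ENNReal.ofReal b ≤ μ (qball ρ y (t * r)) := by
    intro y hy
    refine le_trans ?_ (hdoub y x (t * r) (C₁ * r) hε (by nlinarith) (hball y hy))
    have e : t * r / (C₁ * r) = t / C₁ := by field_simp
    rw [e, hb, ENNReal.ofReal_mul (by positivity), hM, Measure.real,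
      ENNReal.ofReal_toReal (hX.ball_lt_top x r hr).ne]
    gcongr
    intro w (hw : ρ x w < r)
    show ρ x w < C₁ * r
    nlinarith
  have good : ∀ B ⊆ qball ρ x r, ENNReal.ofReal α ≤ μ B → ∃ y ∈ B, ∃ z, y ∉ E ∧ z ∉ E ∧
      z ∈ qball ρ x (C₁ * r) ∧ P₂ z ≤ ENNReal.ofReal (c₁ * W) ∧
      |v y - v z| ≤ 2 * (c₁ * W) ^ (1 / p) := by
    intro B hB hμB
    obtain ⟨y, hyB, hyE, hy1, -⟩ :=
      exists_mem_le_of_lintegral_le hP₁m hP₁m hi₁0 hi₁0 hα hP₁i hP₁i hμB hE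
    obtain ⟨z, hzB, hzE, hz1, hz2⟩ :=
      exists_mem_le_of_lintegral_le hP₁m hP₂m hi₁0 hi₂0 hb0 hP₁i hP₂i (hbmeas y (hB hyB)) hE
    exact ⟨y, hyB, z, hyE, hzE, hball y (hB hyB) hzB, hz2.trans (ENNReal.ofReal_le_ofReal hle₂),
      hP₁ y z hyE hzE hzB _ (by positivity) (hy1.trans (ENNReal.ofReal_le_ofReal hle₁))
        (hz1.trans (ENNReal.ofReal_le_ofReal hle₃))⟩
  obtain ⟨y, hyA, z, hyE, hzE, hz, hzP, hyz⟩ := good A hA hμA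
  obtain ⟨y', hyA', z', hyE', hzE', hz', hzP', hyz'⟩ := good A' hA' hμA'
  have hzz : ρ z z' < C₂ * r := by
    have h1 : ρ x z < C₁ * r := hz
    have h2 : ρ x z' < C₁ * r := hz'
    have h3 : max (ρ z x) (ρ x z') < C₀ * (C₁ * r) :=
      max_lt ((hC₀ x z).trans_lt (by gcongr)) (h2.trans_le (le_mul_of_one_le_left (by positivity) hC₀1))
    calc ρ z z' ≤ C₁ * max (ρ z x) (ρ x z') := hC₁ z z' x
      _ < C₁ * (C₀ * (C₁ * r)) := by gcongr
      _ = _ := by rw [hC₂]; ring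
  have hzv := hP₂ z z' hzE hzE' hzz _ (by positivity) hzP hzP'
  have hone : 1 ≤ 6 * (c₁ * W) ^ (1 / p) := by
    rw [hvA y hyA] at hyz
    rw [hvA' y' hyA'] at hyz'
    have h1 := abs_le.1 hyz
    have h2 := abs_le.1 hyz'
    have h3 := abs_le.1 hzv
    linarith [h1.1, h1.2, h2.1, h2.2, h3.1, h3.2]
  have hone' : 1 ≤ 6 ^ p * (c₁ * W) := by
    have := Real.rpow_le_rpow zero_le_one hone hp.le
    rwa [Real.one_rpow, Real.mul_rpow (by norm_num) (by positivity),
      ← Real.rpow_mul (by positivity), one_div_mul_cancel hp.ne', Real.rpow_one] at this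
  rw [htQ]
  calc t ^ Q ≤ t ^ Q * (6 ^ p * (c₁ * W)) := le_mul_of_one_le_right (by positivity) hone'
    _ = _ := by rw [hW]; field_simp

/-- De Giorgi-type iteration: a sequence satisfying a superlinear recursion and staying away from
zero has a large initial term. -/
theorem exists_le_of_superlinear_recursion {θ C b : ℝ} (hθ1 : θ < 1) (hθ0 : 0 < θ)
    (hC : 0 < C) (hb : 1 < b) :
    ∃ c : ℝ, 0 < c ∧ ∀ (f : ℕ → ℝ) (l : ℝ), 0 < l → (∀ k, l ≤ f k) →
      (∀ k, f (k + 1) ^ θ ≤ C * b ^ k * f k) → c ≤ f 0 := by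
  have hb0 : 0 < b := one_pos.trans hb
  have hθ' : 0 < 1 - θ := sub_pos.2 hθ1
  set σ : ℝ := b ^ (-(1 / (1 - θ))) with hσ
  have hσ0 : 0 < σ := by positivity
  have hσ1 : σ < 1 := Real.rpow_lt_one_of_one_lt_of_neg hb (by
    have : 0 < 1 / (1 - θ) := by positivity
    linarith)
  have hbσ : b * σ ^ (1 - θ) = 1 := by
    rw [hσ, ← Real.rpow_mul hb0.le, neg_mul, one_div_mul_cancel hθ'.ne', Real.rpow_neg_one,
      mul_inv_cancel₀ hb0.ne']
  refine ⟨(σ ^ θ / C) ^ (1 / (1 - θ)), by positivity, fun f l hl hlf hrec => ?_⟩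
  by_contra! hlt
  have hf0 : ∀ k, 0 < f k := fun k => hl.trans_le (hlf k)
  have hc : C * f 0 ^ (1 - θ) ≤ σ ^ θ := by
    have := Real.rpow_le_rpow (hf0 0).le hlt.le hθ'.le
    rw [← Real.rpow_mul (by positivity), one_div_mul_cancel hθ'.ne', Real.rpow_one,
      le_div_iff₀ hC] at this
    linarith
  have hdecay : ∀ k, f k ≤ f 0 * σ ^ k := by
    intro k
    induction k with
    | zero => simp
    | succ k ih =>
      have hsplit : ∀ y : ℝ, 0 < y → y ^ θ * y ^ (1 - θ) = y := fun y hy => by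
        rw [← Real.rpow_add hy, add_sub_cancel, Real.rpow_one]
      have hk : b ^ k * (σ ^ k) ^ (1 - θ) = 1 := by
        rw [← Real.rpow_natCast σ, ← Real.rpow_mul hσ0.le, mul_comm (k : ℝ), Real.rpow_mul hσ0.le,
          Real.rpow_natCast, ← mul_pow, hbσ, one_pow]
      refine (Real.rpow_le_rpow_iff (hf0 _).le (mul_pos (hf0 0) (by positivity)).le hθ0).1 ?_
      calc f (k + 1) ^ θ ≤ C * b ^ k * f k := hrec k
        _ ≤ C * b ^ k * (f 0 * σ ^ k) := by gcongr
        _ = C * b ^ k * ((f 0 ^ θ * f 0 ^ (1 - θ)) * ((σ ^ k) ^ θ * (σ ^ k) ^ (1 - θ))) := by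
          rw [hsplit _ (hf0 0), hsplit _ (by positivity)]
        _ = (C * f 0 ^ (1 - θ)) * (f 0 ^ θ * (σ ^ k) ^ θ) * (b ^ k * (σ ^ k) ^ (1 - θ)) := by ring
        _ = (C * f 0 ^ (1 - θ)) * (f 0 ^ θ * (σ ^ k) ^ θ) := by rw [hk, mul_one]
        _ ≤ σ ^ θ * (f 0 ^ θ * (σ ^ k) ^ θ) :=
          mul_le_mul_of_nonneg_right hc
            (mul_nonneg (Real.rpow_nonneg (hf0 0).le _) (by positivity))
        _ = (f 0 * σ ^ (k + 1)) ^ θ := by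
          rw [pow_succ, Real.mul_rpow (hf0 0).le (by positivity),
            Real.mul_rpow (by positivity) hσ0.le]
          ring
  have hlim : Filter.Tendsto (fun k : ℕ => f 0 * σ ^ k) Filter.atTop (nhds 0) := by
    simpa using (tendsto_pow_atTop_nhds_zero_of_lt_one hσ0.le hσ1).const_mul (f 0)
  exact absurd (ge_of_tendsto' hlim fun k => (hlf k).trans (hdecay k)) (not_le.2 hl)

/-- Under the extension property, the measure of sublevel sets of a Hölder function in `Ω`
satisfies a superlinear recursion. -/
theorem IsQMMS.exists_sublevel_recursion {ρ : X → X → ℝ} {μ : Measure X} (hX : IsQMMS ρ μ)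
    {Q : ℝ} (hQ : 0 < Q) (hdoub : QDoubling ρ μ Q) {Ω : Set X} (hΩmeas : MeasurableSet Ω)
    {s p β K : ℝ} {q : ℝ≥0∞} (hs : 0 < s) (hp : 0 < p) (hq : 0 < q) (hsβ : s < β) (hK : 1 ≤ K)
    (hext : ∃ C : ℝ, 0 < C ∧ ∀ u : X → ℝ, MemNspq ρ μ Ω s p q u →
      ∃ v : X → ℝ, MemNspq ρ μ Set.univ s p q v ∧
        (∀ᵐ x ∂μ.restrict Ω, v x = u x) ∧
        NNorm ρ μ Set.univ s p q v ≤ ENNReal.ofReal C * NNorm ρ μ Ω s p q u) :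
    ∃ C : ℝ, 0 < C ∧ ∀ (h : X → ℝ) (x : X) (r r' a b : ℝ),
      (∀ y z, |h y - h z| ≤ K * ρ y z ^ β) → (∀ y, h y < b → ρ x y < r') → 0 < r' → r' ≤ r →
      a < b → b - a ≤ 1 → 2 * μ (qball ρ x r' ∩ Ω) ≤ μ (qball ρ x r ∩ Ω) →
      0 < μ ({y | h y < a} ∩ Ω) →
      (μ.real ({y | h y < a} ∩ Ω) / μ.real (qball ρ x r)) ^ (Q / (s * p + Q)) ≤
        C * ((b - a) ^ (-(s * p / β)) * r ^ (s * p)) *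
          (μ.real ({y | h y < b} ∩ Ω) / μ.real (qball ρ x r)) := by
  obtain ⟨C₃, hC₃, hcut⟩ := exists_NNorm_cutoff_le (X := X) hs hsβ hK hp hq
  obtain ⟨C₄, hC₄, hext⟩ := hext
  obtain ⟨C₅, hC₅, hcap⟩ := hX.exists_capacity_bound hQ hdoub hs hp
  refine ⟨C₅ * (2 * (C₄ * C₃)) ^ p, by positivity, ?_⟩
  intro h x r r' a b hh hhb hr' hrr' hab hba hgap hpos
  have hr : 0 < r := hr'.trans_le hrr'
  have hβ : 0 < β := hs.trans hsβ
  have hhm : Measurable h := hX.measurable_of_holder hβ (by linarith) hh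
  have hlt : ∀ t, MeasurableSet {y | h y < t} := fun t => measurableSet_lt hhm measurable_const
  have hsub' : {y | h y < b} ∩ Ω ⊆ qball ρ x r' ∩ Ω :=
    inter_subset_inter_left _ fun y hy => hhb y hy
  have hsub : {y | h y < a} ∩ Ω ⊆ {y | h y < b} ∩ Ω :=
    inter_subset_inter_left _ fun y (hy : h y < a) => hy.trans hab
  have hr'top : μ (qball ρ x r' ∩ Ω) ≠ ∞ :=
    ((measure_mono inter_subset_left).trans_lt (hX.ball_lt_top x r' hr')).ne
  have hbtop : μ ({y | h y < b} ∩ Ω) ≠ ∞ := ne_top_of_le_ne_top hr'top (measure_mono hsub')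
  have hatop : μ ({y | h y < a} ∩ Ω) ≠ ∞ := ne_top_of_le_ne_top hbtop (measure_mono hsub)
  set F := μ.real ({y | h y < b} ∩ Ω) with hF
  set α := μ.real ({y | h y < a} ∩ Ω) with hα
  have hα0 : 0 < α := ENNReal.toReal_pos hpos.ne' hatop
  have hF0 : 0 < F := ENNReal.toReal_pos (hpos.trans_le (measure_mono hsub)).ne' hbtop
  have hαe : ENNReal.ofReal α = μ ({y | h y < a} ∩ Ω) := ENNReal.ofReal_toReal hatop
  have hFe : μ.restrict Ω {y | h y < b} = ENNReal.ofReal F := by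
    rw [Measure.restrict_apply (hlt b), hF, Measure.real, ENNReal.ofReal_toReal hbtop]
  obtain ⟨hmem, hnorm⟩ := hcut ρ μ Ω h a b hhm hh hab hba (by rw [hFe]; exact ENNReal.ofReal_ne_top)
  obtain ⟨v, -, hvu, hv⟩ := hext _ hmem
  have hd : 0 < b - a := sub_pos.2 hab
  set τ := C₄ * (C₃ * (b - a) ^ (-(s / β)) * F ^ (1 / p)) with hτ
  have hτ0 : 0 < τ := by positivity
  have hvτ : NdotNorm ρ μ univ s p q v < ENNReal.ofReal (2 * τ) := by
    calc NdotNorm ρ μ univ s p q v ≤ NNorm ρ μ univ s p q v := le_self_add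
      _ ≤ _ := hv
      _ ≤ _ := mul_le_mul_right hnorm _
      _ = ENNReal.ofReal τ := by
        rw [hFe, ENNReal.ofReal_rpow_of_pos hF0, ← ENNReal.ofReal_mul (by positivity),
          ← ENNReal.ofReal_mul hC₄.le]
      _ < _ := (ENNReal.ofReal_lt_ofReal_iff (by positivity)).2 (by linarith)
  rw [NdotNorm, iInf_lt_iff] at hvτ
  obtain ⟨g, hvτ⟩ := hvτ
  rw [iInf_lt_iff] at hvτ
  obtain ⟨hg, hgτ⟩ := hvτ
  rw [Measure.restrict_univ] at hgτ
  rw [ae_restrict_iff' hΩmeas, ae_iff] at hvu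
  set N := {y | ¬(y ∈ Ω → v y = cutoff h a b y)} with hN
  have hv_eq : ∀ y ∈ Ω, y ∉ N → v y = cutoff h a b y := fun y hy hyN => not_not.1 hyN hy
  have hmain := hcap v g (2 * τ) x r α (((qball ρ x r ∩ Ω) \ (qball ρ x r' ∩ Ω)) \ N)
    (({y | h y < a} ∩ Ω) \ N) (by positivity) hg
    (fun k => (le_lqN hq (fun k => lpN μ p fun x => ENNReal.ofReal (g k x)) k).trans hgτ.le) hr
    (fun y hy => hy.1.1.1)
    (fun y hy => (hhb y (lt_trans hy.1.1 hab)).trans_le hrr') ?_ ?_ hα0 ?_ ?_ ?_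
  · refine hmain.trans (le_of_eq ?_)
    have e : (2 * τ) ^ p = (2 * (C₄ * C₃)) ^ p * (b - a) ^ (-(s * p / β)) * F := by
      have : 2 * τ = 2 * (C₄ * C₃) * (b - a) ^ (-(s / β)) * F ^ (1 / p) := by rw [hτ]; ring
      rw [this, Real.mul_rpow (by positivity) (by positivity),
        Real.mul_rpow (by positivity) (by positivity), ← Real.rpow_mul hd.le,
        ← Real.rpow_mul hF0.le, one_div_mul_cancel hp.ne', Real.rpow_one]
      congr 3
      ring
    rw [e]
    ring
  · intro y hy
    rw [hv_eq y hy.1.1.2 hy.2]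
    refine cutoff_eq_zero hab (not_lt.1 fun hlt => hy.1.2 ⟨hhb y hlt, hy.1.1.2⟩)
  · intro y hy
    rw [hv_eq y hy.1.2 hy.2]
    exact cutoff_eq_one hab (le_of_lt hy.1.1)
  · refine ENNReal.toReal_mono (hX.ball_lt_top x r hr).ne (measure_mono ?_)
    exact fun y hy => (hhb y (lt_trans hy.1 hab)).trans_le hrr'
  · rw [measure_sdiff_null hvu, hαe]
    refine le_trans ?_ le_measure_sdiff
    refine (measure_mono (hsub.trans hsub')).trans (ENNReal.le_sub_of_add_le_right hr'top ?_)
    rwa [← two_mul]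
  · rw [measure_sdiff_null hvu, hαe]

/-- Measure density holds at scale `r` around `x` as soon as `Ω` has half of its mass in
`B(x, r)` away from a smaller ball `B(x, δ r)`. -/
theorem IsQMMS.exists_density_of_gap {ρ : X → X → ℝ} {μ : Measure X} (hX : IsQMMS ρ μ)
    {Q : ℝ} (hQ : 0 < Q) (hdoub : QDoubling ρ μ Q) {Ω : Set X} (hΩmeas : MeasurableSet Ω)
    (hΩpos : ∀ x ∈ Ω, ∀ r : ℝ, 0 < r → r ≤ 1 → 0 < μ (qball ρ x r ∩ Ω))
    {s p : ℝ} {q : ℝ≥0∞} (hs : 0 < s) (hp : 0 < p) (hq : 0 < q) (hind : SLtIndex ρ s)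
    (hext : ∃ C : ℝ, 0 < C ∧ ∀ u : X → ℝ, MemNspq ρ μ Ω s p q u →
      ∃ v : X → ℝ, MemNspq ρ μ Set.univ s p q v ∧
        (∀ᵐ x ∂μ.restrict Ω, v x = u x) ∧
        NNorm ρ μ Set.univ s p q v ≤ ENNReal.ofReal C * NNorm ρ μ Ω s p q u)
    {δ : ℝ} (hδ0 : 0 < δ) (hδ1 : δ ≤ 1) :
    ∃ c : ℝ, 0 < c ∧ ∀ x ∈ Ω, ∀ r : ℝ, 0 < r → r ≤ 1 →
      2 * μ (qball ρ x (δ * r) ∩ Ω) ≤ μ (qball ρ x r ∩ Ω) →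
      μ (qball ρ x r) ≤ ENNReal.ofReal c * μ (qball ρ x r ∩ Ω) := by
  obtain ⟨β, K, hsβ, hK, hgauge⟩ := exists_holder_gauge hs hX.quasi hind
  have ρ0 := hX.quasi.1
  have hβ : 0 < β := hs.trans hsβ
  have hK0 : 0 < K := one_pos.trans_le hK
  have hsp : 0 < s * p := by positivity
  obtain ⟨C, hC, hrec⟩ := hX.exists_sublevel_recursion hQ hdoub hΩmeas hs hp hq hsβ hK hext
  set e := s * p / β with he
  have he0 : 0 < e := by positivity
  set b₀ : ℝ := 2 ^ e with hb₀
  have hb₀1 : 1 < b₀ := Real.one_lt_rpow one_lt_two he0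
  have hb₀0 : 0 < b₀ := by positivity
  set D := C * K ^ e * δ ^ (-(s * p)) * b₀ ^ 2 with hD
  obtain ⟨c, hc, hiter⟩ := exists_le_of_superlinear_recursion (θ := Q / (s * p + Q)) (C := D)
    (b := b₀) (by rw [div_lt_one (by positivity)]; linarith) (by positivity) (by positivity) hb₀1
  refine ⟨1 / c, by positivity, fun x hx r hr hr1 hgap => ?_⟩
  obtain ⟨h, hhx, hhρ, hh⟩ := hgauge x
  have hδr : 0 < δ * r := by positivity
  have hδr1 : δ * r ≤ 1 := mul_le_one₀ hδ1 hr.le hr1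
  set η := (δ * r) ^ β / K with hη
  have hη0 : 0 < η := by positivity
  have hη1 : η ≤ 1 := div_le_one_of_le₀ ((Real.rpow_le_one hδr.le hδr1 hβ.le).trans hK) hK0.le
  set t : ℕ → ℝ := fun k => η * (1 / 2 + (1 / 2) ^ (k + 1)) with ht
  have htη : ∀ k, t k ≤ η := fun k => by
    have : (1 / 2 : ℝ) ^ (k + 1) ≤ 1 / 2 := by
      rw [pow_succ]
      have : (1 / 2 : ℝ) ^ k ≤ 1 := pow_le_one₀ (by norm_num) (by norm_num)
      linarith
    exact mul_le_of_le_one_right hη0.le (by linarith)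
  have hηt : ∀ k, η / 2 ≤ t k := fun k => by
    have : (0 : ℝ) < (1 / 2) ^ (k + 1) := by positivity
    simp only [ht]
    nlinarith
  have htd : ∀ k, t k - t (k + 1) = η * (1 / 2) ^ (k + 2) := fun k => by
    simp only [ht]
    ring
  have hball : ∀ y, h y < η → ρ x y < δ * r := fun y hy => by
    refine (Real.rpow_lt_rpow_iff (ρ0 x y) hδr.le hβ).1 ((hhρ y).trans_lt ?_)
    rwa [hη, lt_div_iff₀ hK0, mul_comm] at hy
  have hpos : 0 < μ ({y | h y < η / 2} ∩ Ω) := by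
    set r₀ := (η / 2 / K) ^ (1 / β) with hr₀
    have hr₀1 : r₀ ≤ 1 := by
      refine Real.rpow_le_one (by positivity) (div_le_one_of_le₀ ?_ hK0.le) (by positivity)
      linarith
    refine (hΩpos x hx r₀ (by positivity) hr₀1).trans_le
      (measure_mono (inter_subset_inter_left _ fun y (hy : ρ x y < r₀) => ?_))
    have h1 := (le_abs_self _).trans ((abs_sub_comm _ _).trans_le (hh x y))
    have h2 : ρ x y ^ β < η / 2 / K := by
      have := Real.rpow_lt_rpow (ρ0 x y) hy hβ
      rwa [hr₀, ← Real.rpow_mul (by positivity), one_div_mul_cancel hβ.ne', Real.rpow_one] at this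
    rw [lt_div_iff₀ hK0] at h2
    show h y < η / 2
    linarith
  have htop : ∀ {S : Set X}, S ⊆ qball ρ x r → μ S ≠ ∞ := fun hS =>
    ((measure_mono hS).trans_lt (hX.ball_lt_top x r hr)).ne
  have hballr : ∀ y, h y < η → ρ x y < r := fun y hy =>
    (hball y hy).trans_le (mul_le_of_le_one_left hr.le hδ1)
  have hsubr : ∀ k, {y | h y < t k} ∩ Ω ⊆ qball ρ x r := fun k y hy =>
    hballr y (lt_of_lt_of_le hy.1 (htη k))
  have hhalf : ∀ k, {y | h y < η / 2} ∩ Ω ⊆ {y | h y < t k} ∩ Ω := fun k =>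
    inter_subset_inter_left _ fun y hy => lt_of_lt_of_le hy (hηt k)
  set M := μ.real (qball ρ x r) with hM
  have hM0 : 0 < M := ENNReal.toReal_pos (hX.ball_pos x r hr).ne' (hX.ball_lt_top x r hr).ne
  have hη2 : 0 < μ.real ({y | h y < η / 2} ∩ Ω) :=
    ENNReal.toReal_pos hpos.ne' (htop ((hhalf 0).trans (hsubr 0)))
  have hfinal := hiter (fun k => μ.real ({y | h y < t k} ∩ Ω) / M)
    (μ.real ({y | h y < η / 2} ∩ Ω) / M) (by positivity) (fun k => by
      have : μ.real ({y | h y < η / 2} ∩ Ω) ≤ μ.real ({y | h y < t k} ∩ Ω) :=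
        ENNReal.toReal_mono (htop (hsubr k)) (measure_mono (hhalf k))
      gcongr) (fun k => ?_)
  · have hle : μ.real ({y | h y < t 0} ∩ Ω) ≤ μ.real (qball ρ x r ∩ Ω) :=
      ENNReal.toReal_mono (htop inter_subset_left)
        (measure_mono (subset_inter (hsubr 0) inter_subset_right))
    have hMle : M ≤ 1 / c * μ.real (qball ρ x r ∩ Ω) := by
      have := (le_div_iff₀ hM0).1 hfinal
      rw [one_div, inv_mul_eq_div, le_div_iff₀ hc]
      linarith
    rw [← ENNReal.ofReal_toReal (hX.ball_lt_top x r hr).ne,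
      ← ENNReal.ofReal_toReal (htop (inter_subset_left (t := Ω))),
      ← ENNReal.ofReal_mul (by positivity)]
    exact ENNReal.ofReal_le_ofReal hMle
  · have hlt : t (k + 1) < t k := by
      rw [← sub_pos, htd]
      positivity
    have hstep := hrec h x r (δ * r) (t (k + 1)) (t k) hh
      (fun y hy => hball y (hy.trans_le (htη k))) hδr (mul_le_of_le_one_left hr.le hδ1) hlt
      (by linarith [htη k, hηt (k + 1)]) hgap (hpos.trans_le (measure_mono (hhalf _)))
    refine hstep.trans (le_of_eq ?_)
    have e1 : (t k - t (k + 1)) ^ (-e) * r ^ (s * p) = K ^ e * δ ^ (-(s * p)) * b₀ ^ 2 * b₀ ^ k := by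
      have e2 : ((1 / 2 : ℝ) ^ (k + 2)) ^ (-e) = b₀ ^ 2 * b₀ ^ k := by
        rw [← pow_add, add_comm 2 k, hb₀, one_div, inv_pow, Real.inv_rpow (by positivity),
          Real.rpow_neg (by positivity), inv_inv, ← Real.rpow_natCast, ← Real.rpow_natCast,
          ← Real.rpow_mul (by norm_num), ← Real.rpow_mul (by norm_num), mul_comm]
      have e3 : η ^ (-e) = K ^ e * δ ^ (-(s * p)) * r ^ (-(s * p)) := by
        rw [hη, Real.div_rpow (by positivity) hK0.le, ← Real.rpow_mul hδr.le, Real.rpow_neg hK0.le,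
          div_inv_eq_mul, Real.mul_rpow hδ0.le hr.le]
        have : β * -e = -(s * p) := by rw [he]; field_simp
        rw [this]
        ring
      rw [htd, Real.mul_rpow hη0.le (by positivity), e2, e3]
      have : r ^ (-(s * p)) * r ^ (s * p) = 1 := by
        rw [← Real.rpow_add hr, neg_add_cancel, Real.rpow_zero]
      linear_combination (K ^ e * δ ^ (-(s * p)) * b₀ ^ 2 * b₀ ^ k) * this
    rw [e1, hD]
    ring

theorem le_ofReal_one_div_mul {a : ℝ} (ha : 0 < a) {m n : ℝ≥0∞} (h : ENNReal.ofReal a * m ≤ n) :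
    m ≤ ENNReal.ofReal (1 / a) * n := by
  calc m = ENNReal.ofReal (1 / a) * (ENNReal.ofReal a * m) := by
        rw [← mul_assoc, ← ENNReal.ofReal_mul (by positivity), one_div_mul_cancel ha.ne',
          ENNReal.ofReal_one, one_mul]
    _ ≤ _ := by gcongr

/-- If the gap condition implies measure density, then in locally uniformly perfect sets measure
density holds at every scale at which the set is not contained in a single ball. -/
theorem IsQMMS.exists_density_of_perfect {ρ : X → X → ℝ} {μ : Measure X} (hX : IsQMMS ρ μ)
    {Q : ℝ} (hdoub : QDoubling ρ μ Q) {Ω : Set X} (hΩmeas : MeasurableSet Ω)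
    (hperf : ∃ lam : ℝ, 0 < lam ∧ lam < 1 ∧ LocUnifPerfect ρ Ω lam)
    (hgap : ∀ δ : ℝ, 0 < δ → δ ≤ 1 → ∃ c : ℝ, 0 < c ∧ ∀ x ∈ Ω, ∀ r : ℝ, 0 < r → r ≤ 1 →
      2 * μ (qball ρ x (δ * r) ∩ Ω) ≤ μ (qball ρ x r ∩ Ω) →
      μ (qball ρ x r) ≤ ENNReal.ofReal c * μ (qball ρ x r ∩ Ω)) :
    ∃ c : ℝ, 0 < c ∧ ∀ x ∈ Ω, ∀ r : ℝ, 0 < r → r ≤ 1 → (Ω \ qball ρ x r).Nonempty →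
      μ (qball ρ x r) ≤ ENNReal.ofReal c * μ (qball ρ x r ∩ Ω) := by
  obtain ⟨ρ0, -, ⟨C₀, hC₀1, hC₀⟩, ⟨C₁, hC₁1, hC₁⟩⟩ := hX.quasi
  obtain ⟨κ, hκ, hdoub⟩ := hdoub
  obtain ⟨lam, hlam0, hlam1, hperf⟩ := hperf
  have hC₀0 : 0 < C₀ := one_pos.trans_le hC₀1
  have hC₁0 : 0 < C₁ := one_pos.trans_le hC₁1
  set δ := lam / (C₀ ^ 2 * C₁ ^ 3) with hδ
  have hδ0 : 0 < δ := by positivity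
  have hδC : δ ≤ 1 / C₁ ^ 2 := by
    rw [hδ, div_le_div_iff₀ (by positivity) (by positivity), one_mul]
    have h1 : 1 ≤ C₀ ^ 2 * C₁ := one_le_mul_of_one_le_of_one_le (one_le_pow₀ hC₀1) hC₁1
    calc lam * C₁ ^ 2 ≤ (C₀ ^ 2 * C₁) * C₁ ^ 2 := by gcongr; linarith
      _ = _ := by ring
  have hδ1 : δ ≤ 1 := hδC.trans (div_le_one_of_le₀ (one_le_pow₀ hC₁1) (by positivity))
  obtain ⟨c, hc, hgap⟩ := hgap δ hδ0 hδ1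
  set a := κ * (1 / C₁) ^ Q with ha
  have ha0 : 0 < a := by positivity
  refine ⟨max c (1 / a * c), lt_max_of_lt_left hc, fun x hx r hr hr1 hne => ?_⟩
  by_cases hcase : 2 * μ (qball ρ x (δ * r) ∩ Ω) ≤ μ (qball ρ x r ∩ Ω)
  · refine (hgap x hx r hr hr1 hcase).trans ?_
    gcongr
    exact le_max_left _ _
  rw [not_le] at hcase
  set r₁ := r / (C₀ * C₁ ^ 2) with hr₁
  set r₂ := r / C₁ with hr₂
  have hr₁0 : 0 < r₁ := by positivity
  have hr₂0 : 0 < r₂ := by positivity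
  have hr₂r : r₂ ≤ r := div_le_self hr.le hC₁1
  have hr₁₂ : C₀ * C₁ * r₁ = r₂ := by rw [hr₁, hr₂]; field_simp
  have hr₂C : C₁ * r₂ = r := by rw [hr₂]; field_simp
  have hr₁r₂ : r₁ ≤ r₂ := by
    rw [← hr₁₂]
    exact le_mul_of_one_le_left hr₁0.le (one_le_mul_of_one_le_of_one_le hC₀1 hC₁1)
  obtain ⟨z, hzΩ, hz⟩ := hne
  obtain ⟨y, ⟨hxy, hy⟩, hyx⟩ := hperf x hx r₁ hr₁0 (by linarith)
    ⟨z, hzΩ, fun hlt => hz (lt_of_lt_of_le hlt (hr₁r₂.trans hr₂r))⟩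
  replace hxy : ρ x y < r₁ := hxy
  replace hyx : lam * r₁ ≤ ρ x y := not_lt.1 hyx
  have hsub : qball ρ y r₂ ⊆ qball ρ x r := fun w (hw : ρ y w < r₂) => by
    show ρ x w < r
    rw [← hr₂C]
    refine (hC₁ x w y).trans_lt ?_
    have : max (ρ x y) (ρ y w) < r₂ := max_lt (hxy.trans_le hr₁r₂) hw
    gcongr
  have hsub₁ : qball ρ x (δ * r) ⊆ qball ρ y r₂ := fun w (hw : ρ x w < δ * r) => by
    show ρ y w < r₂
    have h1 : ρ y x < C₀ * r₁ := (hC₀ x y).trans_lt (by gcongr)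
    have h2 : δ * r ≤ C₀ * r₁ := by
      calc δ * r ≤ 1 / C₁ ^ 2 * r := by gcongr
        _ = C₀ * r₁ := by rw [hr₁]; field_simp
    calc ρ y w ≤ C₁ * max (ρ y x) (ρ x w) := hC₁ y w x
      _ < C₁ * (C₀ * r₁) := by gcongr; exact max_lt h1 (hw.trans_le h2)
      _ = r₂ := by rw [← hr₁₂]; ring
  have hsub₂ : qball ρ y (δ * r₂) ⊆ qball ρ y r₂ := fun w (hw : ρ y w < δ * r₂) =>
    hw.trans_le (mul_le_of_le_one_left hr₂0.le hδ1)
  have hdisj : Disjoint (qball ρ y (δ * r₂) ∩ Ω) (qball ρ x (δ * r) ∩ Ω) := by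
    rw [Set.disjoint_left]
    rintro w ⟨hw1, -⟩ ⟨hw2, -⟩
    replace hw1 : ρ y w < δ * r₂ := hw1
    replace hw2 : ρ x w < δ * r := hw2
    have h1 : max (ρ x w) (ρ w y) < C₀ * (δ * r) := by
      refine max_lt (hw2.trans_le (le_mul_of_one_le_left (by positivity) hC₀1)) ?_
      exact (hC₀ y w).trans_lt (by gcongr; exact hw1.trans_le (by gcongr))
    have h2 : ρ x y < lam * r₁ := by
      calc ρ x y ≤ C₁ * max (ρ x w) (ρ w y) := hC₁ x y w
        _ < C₁ * (C₀ * (δ * r)) := by gcongr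
        _ = lam * r₁ := by rw [hδ, hr₁]; field_simp
    linarith
  have hsum : μ (qball ρ y (δ * r₂) ∩ Ω) + μ (qball ρ x (δ * r) ∩ Ω) ≤ μ (qball ρ y r₂ ∩ Ω) := by
    rw [← measure_union hdisj ((hX.measurableSet_ball x _ (by positivity)).inter hΩmeas)]
    exact measure_mono (union_subset (inter_subset_inter_left _ hsub₂)
      (inter_subset_inter_left _ hsub₁))
  have hmono : μ (qball ρ y r₂ ∩ Ω) ≤ μ (qball ρ x r ∩ Ω) :=
    measure_mono (inter_subset_inter_left _ hsub)
  have hlt : μ (qball ρ y (δ * r₂) ∩ Ω) < μ (qball ρ x (δ * r) ∩ Ω) := by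
    rw [two_mul] at hcase
    exact lt_of_add_lt_add_right ((hsum.trans hmono).trans_lt hcase)
  have hy_gap : 2 * μ (qball ρ y (δ * r₂) ∩ Ω) ≤ μ (qball ρ y r₂ ∩ Ω) := by
    rw [two_mul]
    exact le_trans (by gcongr) hsum
  have hdy := hgap y hy r₂ hr₂0 (hr₂r.trans hr1) hy_gap
  have hd := hdoub y x r₂ r hr₂0 hr₂r hsub
  rw [show r₂ / r = 1 / C₁ by rw [hr₂]; field_simp] at hd
  calc μ (qball ρ x r) ≤ ENNReal.ofReal (1 / a) * μ (qball ρ y r₂) := le_ofReal_one_div_mul ha0 hd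
    _ ≤ ENNReal.ofReal (1 / a) * (ENNReal.ofReal c * μ (qball ρ x r ∩ Ω)) := by
      gcongr
      exact hdy.trans (by gcongr)
    _ = ENNReal.ofReal (1 / a * c) * μ (qball ρ x r ∩ Ω) := by
      rw [← mul_assoc, ← ENNReal.ofReal_mul (by positivity)]
    _ ≤ _ := by
      gcongr
      exact le_max_right _ _

/-- Measure density at the scales at which a set is not contained in a single ball implies measure
density at all scales up to `1`. -/
theorem IsQMMS.measDensity_of_small_scales {ρ : X → X → ℝ} {μ : Measure X} (hX : IsQMMS ρ μ)
    {Q : ℝ} (hQ : 0 < Q) (hdoub : QDoubling ρ μ Q) {Ω : Set X}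
    (hΩpos : ∀ x ∈ Ω, ∀ r : ℝ, 0 < r → r ≤ 1 → 0 < μ (qball ρ x r ∩ Ω))
    (hsmall : ∃ c : ℝ, 0 < c ∧ ∀ x ∈ Ω, ∀ r : ℝ, 0 < r → r ≤ 1 → (Ω \ qball ρ x r).Nonempty →
      μ (qball ρ x r) ≤ ENNReal.ofReal c * μ (qball ρ x r ∩ Ω)) :
    MeasDensity ρ μ Ω := by
  obtain ⟨ρ0, ρz, ⟨C₀, hC₀1, hC₀⟩, ⟨C₁, hC₁1, hC₁⟩⟩ := hX.quasi
  have hC₀0 : 0 < C₀ := one_pos.trans_le hC₀1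
  have hC₁0 : 0 < C₁ := one_pos.trans_le hC₁1
  obtain ⟨κ, hκ, hdoub⟩ := hdoub
  obtain ⟨c, hc, hsmall⟩ := hsmall
  rcases Ω.subsingleton_or_nontrivial with hΩ | ⟨y, hy, z, hz, hyz⟩
  · rcases hΩ.eq_empty_or_singleton with rfl | ⟨x, rfl⟩
    · exact ⟨1, one_pos, fun x hx => hx.elim⟩
    have hcap : ∀ r : ℝ, 0 < r → qball ρ x r ∩ {x} = {x} := fun r hr =>
      inter_eq_right.2 (singleton_subset_iff.2 (show ρ x x < r by rwa [(ρz x x).2 rfl]))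
    have hpos := hΩpos x rfl 1 one_pos le_rfl
    rw [hcap 1 one_pos] at hpos
    have htop := (hX.ball_lt_top x 1 one_pos).ne
    have hxtop : μ {x} ≠ ∞ := by
      rw [← hcap 1 one_pos]
      exact ne_top_of_le_ne_top htop (measure_mono inter_subset_left)
    have hx0 : 0 < μ.real {x} := ENNReal.toReal_pos hpos.ne' hxtop
    have hb0 : 0 < μ.real (qball ρ x 1) :=
      ENNReal.toReal_pos (hX.ball_pos x 1 one_pos).ne' htop
    refine ⟨μ.real (qball ρ x 1) / μ.real {x}, by positivity, ?_⟩
    rintro w rfl r hr hr1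
    rw [hcap r hr, ← ENNReal.ofReal_toReal hxtop, ← ENNReal.ofReal_mul (by positivity)]
    change _ ≤ ENNReal.ofReal (_ / μ.real {w} * μ.real {w})
    rw [div_mul_cancel₀ _ hx0.ne', Measure.real, ENNReal.ofReal_toReal htop]
    exact measure_mono fun u (hu : ρ w u < r) => hu.trans_le hr1
  have hd0 : 0 < ρ y z := (ρ0 y z).lt_of_ne fun h => hyz ((ρz y z).1 h.symm)
  set r₀ := min 1 (ρ y z / (C₀ * C₁)) with hr₀
  have hr₀0 : 0 < r₀ := lt_min one_pos (by positivity)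
  have hr₀1 : r₀ ≤ 1 := min_le_left _ _
  have hfar : ∀ x r, r ≤ r₀ → (Ω \ qball ρ x r).Nonempty := by
    intro x r hr
    by_contra! hcon
    rw [sdiff_eq_empty] at hcon
    have h1 : ρ x y < r := hcon hy
    have h2 : ρ x z < r := hcon hz
    have hr0 : 0 < r := (ρ0 x y).trans_lt h1
    have h3 : max (ρ y x) (ρ x z) < C₀ * r :=
      max_lt ((hC₀ x y).trans_lt (by gcongr))
        (h2.trans_le (le_mul_of_one_le_left hr0.le hC₀1))
    have h4 : ρ y z < C₁ * (C₀ * r) := (hC₁ y z x).trans_lt (by gcongr)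
    have h5 : r ≤ ρ y z / (C₀ * C₁) := hr.trans (min_le_right _ _)
    rw [le_div_iff₀ (by positivity)] at h5
    linarith
  set a := κ * r₀ ^ Q with ha
  have ha0 : 0 < a := by positivity
  refine ⟨max c (1 / a * c), lt_max_of_lt_left hc, fun x hx r hr hr1 => ?_⟩
  rcases le_or_gt r r₀ with hrr | hrr
  · refine (hsmall x hx r hr hr1 (hfar x r hrr)).trans ?_
    gcongr
    exact le_max_left _ _
  have hsub : qball ρ x r₀ ⊆ qball ρ x r := fun w (hw : ρ x w < r₀) => hw.trans hrr
  have hd : ENNReal.ofReal a * μ (qball ρ x r) ≤ μ (qball ρ x r₀) := by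
    refine le_trans ?_ (hdoub x x r₀ r hr₀0 hrr.le hsub)
    gcongr
    rw [ha]
    gcongr
    exact le_div_self hr₀0.le hr hr1
  calc μ (qball ρ x r) ≤ ENNReal.ofReal (1 / a) * μ (qball ρ x r₀) := le_ofReal_one_div_mul ha0 hd
    _ ≤ ENNReal.ofReal (1 / a) * (ENNReal.ofReal c * μ (qball ρ x r ∩ Ω)) := by
      gcongr
      exact (hsmall x hx r₀ hr₀0 hr₀1 (hfar x r₀ le_rfl)).trans (by gcongr)
    _ = ENNReal.ofReal (1 / a * c) * μ (qball ρ x r ∩ Ω) := by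
      rw [← mul_assoc, ← ENNReal.ofReal_mul (by positivity)]
    _ ≤ _ := by
      gcongr
      exact le_max_right _ _

/-- Theorem 4.5 ((b) ⟹ (a)): if a locally uniformly perfect set `Ω` is an
`N^s_{p,q}`-extension domain for some `p ∈ (0,∞)`, `q ∈ (0,∞]`, and `s < ind(X,ρ)`,
then `Ω` satisfies the measure density condition. -/
theorem N_extension_implies_measure_density
    {X : Type*} [MeasurableSpace X] (ρ : X → X → ℝ) (μ : Measure X)
    (hX : IsQMMS ρ μ) (hreg : BorelRegular μ)
    (Q : ℝ) (hQ : 0 < Q) (hdoub : QDoubling ρ μ Q)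
    (Ω : Set X) (hΩmeas : MeasurableSet Ω)
    (hΩpos : ∀ x ∈ Ω, ∀ r : ℝ, 0 < r → r ≤ 1 → 0 < μ (qball ρ x r ∩ Ω))
    (hperf : ∃ lam : ℝ, 0 < lam ∧ lam < 1 ∧ LocUnifPerfect ρ Ω lam)
    (s p : ℝ) (q : ℝ≥0∞) (hs : 0 < s) (hp : 0 < p) (hq : 0 < q)
    (hind : SLtIndex ρ s)
    (hext : ∃ C : ℝ, 0 < C ∧ ∀ u : X → ℝ, MemNspq ρ μ Ω s p q u →
      ∃ v : X → ℝ, MemNspq ρ μ Set.univ s p q v ∧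
        (∀ᵐ x ∂μ.restrict Ω, v x = u x) ∧
        NNorm ρ μ Set.univ s p q v ≤ ENNReal.ofReal C * NNorm ρ μ Ω s p q u) :
    MeasDensity ρ μ Ω := by
  exact hX.measDensity_of_small_scales hQ hdoub hΩpos
    (hX.exists_density_of_perfect hdoub hΩmeas hperf fun _ hδ0 hδ1 =>
      hX.exists_density_of_gap hQ hdoub hΩmeas hΩpos hs hp hq hind hext hδ0 hδ1)

end HajlaszPaper
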